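/- Let A be a simple C*-algebra with stable rank one and K₁(A) = 0. Then C([0,1],A) has stable rank one. -/

import Mathlib

noncomputable section

set_option maxHeartbeats 1000000

def StableRankOne (A : Type*) [NonUnitalCStarAlgebra A] : Prop :=
  Dense {x : Unitization ℂ A | IsUnit x}

def K1Trivial (B : Type*) [NonUnitalCStarAlgebra B] : Prop :=
  ∀ n : ℕ, 0 < n → ∀ u : unitary (Matrix (Fin n) (Fin n) (Unitization ℂ B)),
    ∃ (k : ℕ) (h : Matrix.fromBlocks u.1 0 0
        (1 : Matrix (Fin k) (Fin k) (Unitization ℂ B)) ∈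
        unitary (Matrix (Fin n ⊕ Fin k) (Fin n ⊕ Fin k) (Unitization ℂ B))),
      Joined (1 : unitary (Matrix (Fin n ⊕ Fin k) (Fin n ⊕ Fin k) (Unitization ℂ B)))
        ⟨Matrix.fromBlocks u.1 0 0 1, h⟩

/-- A C*-algebra is simple if it is nonzero and has no nontrivial closed two-sided ideals. -/
def IsSimpleCStarAlgebra (A : Type*) [NonUnitalCStarAlgebra A] : Prop :=
  Nontrivial A ∧ ∀ I : TwoSidedIdeal A, IsClosed (I : Set A) → I = ⊥ ∨ I = ⊤

namespace RowReduction

variable {S : Type*} [Ring S] {n : Type*} [Fintype n] [DecidableEq n]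

/-- If `1 + y ⬝ x` is invertible, then so is the rank-one perturbation `1 + x ⊗ y`. -/
theorem isUnit_one_add_vecMulVec {x y : n → S} (h : IsUnit (1 + y ⬝ᵥ x)) :
    IsUnit (1 + Matrix.vecMulVec x y) := by
  obtain ⟨u, hu⟩ := h
  have key : ∀ s t : S, Matrix.vecMulVec (fun i => x i * s) y * Matrix.vecMulVec (fun i => x i * t) y
      = Matrix.vecMulVec (fun i => x i * (s * (y ⬝ᵥ x) * t)) y := by
    intro s t
    ext i j
    simp only [Matrix.mul_apply, Matrix.vecMulVec_apply, dotProduct, Finset.mul_sum, Finset.sum_mul, mul_assoc]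
  have hx : Matrix.vecMulVec x y = Matrix.vecMulVec (fun i => x i * 1) y := by simp
  have hyx : y ⬝ᵥ x = u - 1 := by rw [hu]; abel
  refine ⟨⟨1 + Matrix.vecMulVec x y, 1 + Matrix.vecMulVec (fun i => x i * (-(↑u⁻¹ : S))) y, ?_, ?_⟩, rfl⟩
  · rw [mul_add, mul_one, add_mul, one_mul, add_assoc, hx, key, hyx]
    rw [add_eq_left]
    ext i j
    simp only [Matrix.add_apply, Matrix.vecMulVec_apply, Matrix.zero_apply]
    rw [← add_mul, ← add_mul, ← mul_add, ← mul_add]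
    have : (1 : S) + (-(↑u⁻¹ : S) + 1 * (↑u - 1) * -(↑u⁻¹ : S)) = 0 := by
      simp [sub_mul]; abel
    rw [this]; simp
  · rw [mul_add, mul_one, add_mul, one_mul, add_assoc, hx, key, hyx]
    rw [add_eq_left]
    ext i j
    simp only [Matrix.add_apply, Matrix.vecMulVec_apply, Matrix.zero_apply]
    rw [← add_mul, ← add_mul, ← mul_add, ← mul_add]
    have : -(↑u⁻¹ : S) + (1 + -(↑u⁻¹ : S) * (↑u - 1) * 1) = 0 := by
      simp [mul_sub]
    rw [this]; simp

theorem vecMul_one_add_vecMulVec (c x y : n → S) :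
    Matrix.vecMul c (1 + Matrix.vecMulVec x y) = c + fun j => (c ⬝ᵥ x) * y j := by
  rw [Matrix.vecMul_add, Matrix.vecMul_one, Matrix.vecMul_vecMulVec]
  rfl

/-- A row `c` with right inverse `r` can be moved to every row that is close to it in the
sense that its product with `r` is invertible. -/
theorem exists_isUnit_vecMul_eq {c c' r : n → S} (h : c ⬝ᵥ r = 1) (h' : IsUnit (c' ⬝ᵥ r)) :
    ∃ E : Matrix n n S, IsUnit E ∧ Matrix.vecMul c E = c' := by
  refine ⟨1 + Matrix.vecMulVec r (c' - c), isUnit_one_add_vecMulVec ?_, ?_⟩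
  · rwa [sub_dotProduct, h, add_sub_cancel]
  · rw [vecMul_one_add_vecMulVec, h]
    ext j; simp

/-- The rows that invertible matrices move to the `l`-th standard row. -/
def reducible (S : Type*) [Ring S] {n : Type*} [Fintype n] [DecidableEq n] (l : n) : Set (n → S) :=
  {c | ∃ E : Matrix n n S, IsUnit E ∧ Matrix.vecMul c E = Pi.single l 1}

theorem reducible_of_vecMul {l : n} {c : n → S} {E : Matrix n n S} (hE : IsUnit E)
    (h : Matrix.vecMul c E ∈ reducible S l) : c ∈ reducible S l := by
  obtain ⟨F, hF, h⟩ := h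
  exact ⟨E * F, hE.mul hF, by rw [← Matrix.vecMul_vecMul, h]⟩

theorem reducible_of_isUnit {l : n} {c : n → S} {i : n} (h : IsUnit (c i)) :
    c ∈ reducible S l := by
  obtain ⟨u, hu⟩ := h
  have h1 : c ⬝ᵥ Pi.single i (↑u⁻¹ : S) = 1 := by simp [← hu]
  by_cases hil : i = l
  · subst hil
    exact exists_isUnit_vecMul_eq h1 (by simp)
  · obtain ⟨E, hE, hc⟩ := exists_isUnit_vecMul_eq (c' := Pi.single i 1 + Pi.single l 1) h1
      (by simp [hil])
    refine reducible_of_vecMul hE ?_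
    rw [hc]
    exact exists_isUnit_vecMul_eq (r := Pi.single l 1) (by simp [Ne.symm hil]) (by simp)

section Topological

variable [TopologicalSpace S] [IsTopologicalRing S]

theorem closure_reducible_of_vecMul {l : n} {c : n → S} {E : Matrix n n S} (hE : IsUnit E)
    (h : Matrix.vecMul c E ∈ closure (reducible S l)) : c ∈ closure (reducible S l) := by
  obtain ⟨u, rfl⟩ := hE
  have hc : c = Matrix.vecMul (Matrix.vecMul c (u : Matrix n n S)) (↑u⁻¹ : Matrix n n S) := by
    rw [Matrix.vecMul_vecMul, Units.mul_inv, Matrix.vecMul_one]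
  rw [hc]
  have hcont : Continuous fun v : n → S => Matrix.vecMul v (↑u⁻¹ : Matrix n n S) :=
    continuous_id.matrix_vecMul continuous_const
  refine closure_mono ?_ (image_closure_subset_closure_image hcont ⟨_, h, rfl⟩)
  rintro _ ⟨v, hv, rfl⟩
  refine reducible_of_vecMul u.isUnit ?_
  rwa [Matrix.vecMul_vecMul, Units.inv_mul, Matrix.vecMul_one]

theorem closure_reducible_of_update_add {l i j : n} (hij : i ≠ j) {c : n → S} (s : S)
    (h : Function.update c j (c j + c i * s) ∈ closure (reducible S l)) :
    c ∈ closure (reducible S l) := by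
  have hE : IsUnit (1 + Matrix.vecMulVec (Pi.single i s) (Pi.single j (1 : S))) :=
    isUnit_one_add_vecMulVec (by simp [hij])
  refine closure_reducible_of_vecMul hE ?_
  convert h using 1
  rw [vecMul_one_add_vecMulVec]
  ext k
  by_cases hk : k = j
  · subst hk; simp
  · simp [hk]

open Polynomial

variable {R : Type*} [Ring R] [TopologicalSpace R]

/-- The Euclidean algorithm, with leading coefficients perturbed to be invertible. -/
theorem closure_reducible_of_polynomial (hd : Dense {r : R | IsUnit r}) (φ : R[X] →+* S)
    (hφ : ∀ k, Continuous fun r => φ (monomial k r)) {l : n} (N : ℕ) :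
    ∀ (i j : n), i ≠ j → ∀ (p q : R[X]), p.natDegree ≤ N → ∀ c : n → S, c i = φ p → c j = φ q →
      c ∈ closure (reducible S l) := by
  rcases subsingleton_or_nontrivial R with hR | hR
  · intro i j _ p q _ c _ _
    have : Subsingleton S := by
      refine subsingleton_of_zero_eq_one ?_
      rw [← map_zero φ, ← map_one φ, Subsingleton.elim (0 : R[X]) 1]
    exact subset_closure ⟨1, isUnit_one, Subsingleton.elim _ _⟩
  induction N using Nat.strong_induction_on with
  | _ N ih =>
  intro i j hij p q hp c hci hcj
  let f : R → (n → S) := fun r => Function.update c i (φ (p.erase N) + φ (monomial N r))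
  have hf : Continuous f := continuous_const.update i (continuous_const.add (hφ N))
  have hfc : f (p.coeff N) = c := by
    simp only [f]
    rw [← map_add, add_comm, monomial_add_erase, ← hci, Function.update_eq_self]
  rw [← hfc]
  suffices h : ∀ r, IsUnit r → f r ∈ closure (reducible S l) by
    have := image_closure_subset_closure_image hf ⟨p.coeff N, hd _, rfl⟩
    rw [← closure_closure]
    refine closure_mono ?_ this
    rintro _ ⟨r, hr, rfl⟩
    exact h r hr
  rintro _ ⟨u, rfl⟩
  let p' : R[X] := p.erase N + monomial N (u : R)
  have hdeg : p'.degree ≤ N := by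
    refine (degree_add_le _ _).trans (max_le ?_ (degree_monomial_le _ _))
    exact (degree_erase_le _ _).trans (degree_le_of_natDegree_le hp)
  have hcoeff : p'.coeff N = u := by simp [p', erase_same]
  have hfi : f u i = φ p' := by simp [f, p']
  have hfj : f u j = φ q := by simp [f, hij.symm, hcj]
  let p'' : R[X] := p' * C (↑u⁻¹ : R)
  have hmonic : p''.Monic := by
    refine monic_of_degree_le N ?_ ?_
    · exact (degree_mul_le _ _).trans ((add_le_add hdeg degree_C_le).trans (by simp))
    · simp [p'', hcoeff]
  rcases Nat.eq_zero_or_pos N with hN | hN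
  · have hpC : p' = C (u : R) := by
      rw [hN] at hdeg hcoeff
      rw [eq_C_of_degree_le_zero hdeg, hcoeff]
    exact subset_closure (reducible_of_isUnit (i := i)
      (by rw [hfi, hpC]; exact (u.isUnit.map (C : R →+* R[X])).map φ))
  · have hdiv := modByMonic_add_div q p''
    refine closure_reducible_of_update_add hij (φ (-(C (↑u⁻¹ : R) * (q /ₘ p'')))) ?_
    refine ih (N - 1) (by omega) j i hij.symm (q %ₘ p'') p' ?_ _ ?_ ?_
    · have h1 : (q %ₘ p'').degree < N := (degree_modByMonic_lt q hmonic).trans_le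
        ((degree_mul_le _ _).trans ((add_le_add hdeg degree_C_le).trans (by simp)))
      by_cases h0 : q %ₘ p'' = 0
      · simp [h0]
      · have := (natDegree_lt_iff_degree_lt h0).2 h1
        omega
    · rw [Function.update_self, hfj, hfi, ← map_mul, ← map_add]
      congr 1
      rw [mul_neg, ← mul_assoc]
      rw [← sub_eq_add_neg, sub_eq_iff_eq_add]
      exact hdiv.symm
    · rw [Function.update_of_ne hij, hfi]

/-- If `S` is topologically generated by Laurent polynomials over a ring with dense units in a
central invertible element, then rows of length at least two are generically reducible. -/
theorem dense_reducible (hd : Dense {r : R | IsUnit r}) (φ : R[X] →+* S)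
    (hφ : ∀ k, Continuous fun r => φ (monomial k r)) (hX : IsUnit (φ X))
    (hS : Dense {x : S | ∃ (K : ℕ) (p : R[X]), x * φ X ^ K = φ p}) {l i j : n} (hij : i ≠ j) :
    Dense (reducible S l) := by
  intro c
  let f : S × S → (n → S) := fun x => Function.update (Function.update c i x.1) j x.2
  have hf : Continuous f := ((continuous_const (y := c)).update i continuous_fst).update j continuous_snd
  have hfc : f (c i, c j) = c := by simp [f]
  rw [← hfc, ← closure_closure]
  have := image_closure_subset_closure_image hf ⟨(c i, c j), (hS.prod hS) _, rfl⟩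
  refine closure_mono ?_ this
  rintro _ ⟨⟨x, y⟩, ⟨⟨K, p, hx⟩, ⟨K', q, hy⟩⟩, rfl⟩
  have hE : IsUnit (Matrix.diagonal fun _ : n => φ X ^ (K + K')) :=
    (hX.pow (K + K')).map (Matrix.scalar n)
  refine closure_reducible_of_vecMul hE ?_
  refine closure_reducible_of_polynomial hd φ hφ (p * X ^ K').natDegree i j hij (p * X ^ K') (q * X ^ K) le_rfl _ ?_ ?_
  · simp [Matrix.vecMul_diagonal, f, hij, pow_add, ← mul_assoc, hx]
  · rw [add_comm]
    simp [Matrix.vecMul_diagonal, f, pow_add, ← mul_assoc, hy]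

end Topological
end RowReduction

namespace CircleAlgebra
open Polynomial

variable (R : Type*) [NormedRing R] [NormedAlgebra ℂ R]

/-- The constant functions on the circle. -/
def constHom : R →+* C(UnitAddCircle, R) where
  toFun := ContinuousMap.const _
  map_one' := rfl
  map_mul' _ _ := rfl
  map_zero' := rfl
  map_add' _ _ := rfl

variable {R} in
/-- An elementary tensor of a scalar function and a vector. -/
def tensor (g : C(UnitAddCircle, ℂ)) (r : R) : C(UnitAddCircle, R) :=
  ⟨fun t => g t • r, by fun_prop⟩

/-- Evaluation of polynomials at the coordinate function of the circle. -/
def polyHom : R[X] →+* C(UnitAddCircle, R) :=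
  eval₂RingHom' (constHom R) (tensor (fourier 1) 1) fun a => by
    ext t
    simp [tensor, constHom]

variable {R}

theorem tensor_fourier_one_pow (k : ℕ) :
    tensor (fourier 1) (1 : R) ^ k = tensor (fourier k) 1 := by
  induction k with
  | zero => ext t; simp [tensor]
  | succ k ih =>
    rw [pow_succ, ih]
    ext t
    simp [tensor, smul_smul, mul_comm]

theorem polyHom_monomial (k : ℕ) (r : R) : polyHom R (monomial k r) = tensor (fourier k) r := by
  have : polyHom R (monomial k r) = constHom R r * tensor (fourier 1) 1 ^ k := by
    simp [polyHom, eval₂RingHom']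
  rw [this, tensor_fourier_one_pow]
  ext t
  simp only [tensor, ContinuousMap.mul_apply, ContinuousMap.coe_mk, mul_smul_comm, mul_one]
  rfl

theorem polyHom_X_pow (k : ℕ) : polyHom R X ^ k = tensor (fourier k) 1 := by
  rw [← map_pow, ← monomial_one_right_eq_X_pow, polyHom_monomial]

theorem continuous_tensor_left (r : R) : Continuous fun g => tensor g r := by
  have : (fun g => tensor g r) = fun g : C(UnitAddCircle, ℂ) =>
      (⟨fun c : ℂ => c • r, by fun_prop⟩ : C(ℂ, R)).comp g := rfl
  rw [this]
  fun_prop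

theorem continuous_tensor_right (g : C(UnitAddCircle, ℂ)) : Continuous fun r : R => tensor g r := by
  refine ContinuousMap.continuous_of_continuous_uncurry _ ?_
  simp only [tensor, Function.uncurry_def, ContinuousMap.coe_mk]
  fun_prop

theorem isUnit_polyHom_X : IsUnit (polyHom R X) := by
  have h := polyHom_X_pow (R := R) 1
  rw [pow_one] at h
  rw [h]
  refine ⟨⟨_, tensor (fourier (-1)) 1, ?_, ?_⟩, rfl⟩ <;>
  · ext t
    have : fourier (T := 1) (-1) t * fourier 1 t = 1 := by rw [← fourier_add]; simp
    simp only [tensor, ContinuousMap.mul_apply, ContinuousMap.coe_mk, smul_mul_smul_comm, mul_one,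
      ContinuousMap.one_apply, Nat.cast_one]
    first | rw [this, one_smul] | rw [mul_comm, this, one_smul]

variable (R) in
/-- The functions on the circle that are Laurent polynomials. -/
def laurent : AddSubmonoid C(UnitAddCircle, R) where
  carrier := {x | ∃ (K : ℕ) (p : R[X]), x * polyHom R X ^ K = polyHom R p}
  zero_mem' := ⟨0, 0, by simp⟩
  add_mem' := by
    rintro x y ⟨K, p, hx⟩ ⟨K', q, hy⟩
    refine ⟨K + K', p * X ^ K' + q * X ^ K, ?_⟩
    rw [add_mul, map_add, map_mul, map_mul, map_pow, map_pow, ← hx, ← hy, mul_assoc, mul_assoc,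
      ← pow_add, ← pow_add, add_comm K' K]

theorem tensor_mem_laurent {g : C(UnitAddCircle, ℂ)}
    (hg : g ∈ Submodule.span ℂ (Set.range (@fourier 1))) : ∀ r : R, tensor g r ∈ laurent R := by
  induction hg using Submodule.span_induction with
  | mem g hg =>
    obtain ⟨n, rfl⟩ := hg
    intro r
    refine ⟨n.natAbs, monomial (n + n.natAbs).toNat r, ?_⟩
    rw [polyHom_X_pow, polyHom_monomial, Int.toNat_of_nonneg (by omega)]
    ext t
    simp [tensor, smul_smul, mul_comm]
  | zero =>
    intro r
    convert (laurent R).zero_mem using 1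
    ext t; simp [tensor]
  | add g g' _ _ h h' =>
    intro r
    convert (laurent R).add_mem (h r) (h' r) using 1
    ext t; simp [tensor, add_smul]
  | smul c g _ h =>
    intro r
    convert h (c • r) using 1
    ext t; simp [tensor, smul_smul, mul_comm]

theorem dense_laurent : Dense (laurent R : Set C(UnitAddCircle, R)) := by
  have htensor : ∀ (g : C(UnitAddCircle, ℂ)) (r : R), tensor g r ∈ closure (laurent R : Set _) := by
    intro g r
    have hg : g ∈ closure (Submodule.span ℂ (Set.range (@fourier 1)) : Set C(UnitAddCircle, ℂ)) := by
      rw [← Submodule.topologicalClosure_coe, span_fourier_closure_eq_top]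
      trivial
    refine closure_mono ?_ (image_closure_subset_closure_image (continuous_tensor_left r)
      ⟨g, hg, rfl⟩)
    rintro _ ⟨g', hg', rfl⟩
    exact tensor_mem_laurent hg' r
  intro f
  rw [← closure_closure]
  refine Metric.mem_closure_iff.2 fun ε hε => ?_
  obtain ⟨s, hs⟩ := isCompact_univ.elim_finite_subcover
    (fun x : UnitAddCircle => f ⁻¹' Metric.ball (f x) (ε / 2))
    (fun x => Metric.isOpen_ball.preimage f.continuous)
    (fun x _ => Set.mem_iUnion.2 ⟨x, by simp [hε]⟩)
  obtain ⟨ρ, hρ⟩ := PartitionOfUnity.exists_isSubordinate isClosed_univ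
    (fun x : s => f ⁻¹' Metric.ball (f x) (ε / 2))
    (fun x => Metric.isOpen_ball.preimage f.continuous)
    (by
      intro y hy
      obtain ⟨x, hx, hy⟩ := Set.mem_iUnion₂.1 (hs hy)
      exact Set.mem_iUnion.2 ⟨⟨x, hx⟩, hy⟩)
  refine ⟨∑ i : s, tensor ((ContinuousMap.mk Complex.ofReal Complex.continuous_ofReal).comp (ρ i))
    (f i), ?_, ?_⟩
  · exact (laurent R).topologicalClosure.sum_mem fun i _ => htensor _ _
  · refine lt_of_le_of_lt ((ContinuousMap.dist_le (half_pos hε).le).2 fun t => ?_) (half_lt_self hε)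
    have h := ρ.finsum_smul_mem_convex (x := t) (g := fun i _ => f i) trivial
      (t := Metric.closedBall (f t) (ε / 2)) (fun i hi => ?_) (convex_closedBall _ _)
    · rw [finsum_eq_sum_of_fintype] at h
      rw [dist_comm]
      convert h using 1
      simp [tensor]
    · have : t ∈ f ⁻¹' Metric.ball (f i) (ε / 2) := hρ i (subset_tsupport _ hi)
      rw [Metric.mem_closedBall, dist_comm]
      exact (Metric.mem_ball.1 this).le

theorem dense_reducible (hd : Dense {r : R | IsUnit r}) {n : Type*} [Fintype n] [DecidableEq n]
    {l i j : n} (hij : i ≠ j) : Dense (RowReduction.reducible C(UnitAddCircle, R) l) :=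
  RowReduction.dense_reducible hd (polyHom R)
    (fun k => by simpa only [polyHom_monomial] using continuous_tensor_right _)
    isUnit_polyHom_X dense_laurent hij

end CircleAlgebra

namespace StableCancellation

theorem isUnit_toBlocks₁₁ {R m n : Type*} [Ring R] [Fintype m] [DecidableEq m] [Fintype n]
    [DecidableEq n] {M : Matrix (m ⊕ n) (m ⊕ n) R} (hM : IsUnit M) (h₁ : M.toBlocks₂₁ = 0)
    (h₂ : M.toBlocks₂₂ = 1) : IsUnit M.toBlocks₁₁ := by
  obtain ⟨u, rfl⟩ := hM
  set M : Matrix (m ⊕ n) (m ⊕ n) R := ↑u with hM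
  set N : Matrix (m ⊕ n) (m ⊕ n) R := ↑u⁻¹ with hN
  have e₁ : M * N = 1 := u.mul_inv
  have e₂ : N * M = 1 := u.inv_mul
  rw [← Matrix.fromBlocks_toBlocks M, ← Matrix.fromBlocks_toBlocks N, h₁, h₂,
    Matrix.fromBlocks_multiply, ← Matrix.fromBlocks_one, Matrix.fromBlocks_inj] at e₁ e₂
  obtain ⟨a₁, -, a₃, -⟩ := e₁
  obtain ⟨b₁, -, -, -⟩ := e₂
  rw [Matrix.zero_mul, Matrix.one_mul, zero_add] at a₃
  rw [a₃, Matrix.mul_zero, add_zero] at a₁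
  rw [Matrix.mul_zero, add_zero] at b₁
  exact ⟨⟨_, _, a₁, b₁⟩, rfl⟩

theorem joinedIn_isUnit_submatrix {R m n : Type*} [Ring R] [TopologicalSpace R] [Fintype m] [DecidableEq m] [Fintype n]
    [DecidableEq n] (e : m ≃ n) {A B : Matrix n n R} (h : JoinedIn {M | IsUnit M} A B) :
    JoinedIn {M | IsUnit M} (A.submatrix e e) (B.submatrix e e) := by
  refine (h.map (f := fun M => M.submatrix e e) (continuous_id.matrix_submatrix e e)).mono ?_
  rintro _ ⟨_, ⟨u, rfl⟩, rfl⟩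
  refine ⟨⟨(u : Matrix n n R).submatrix e e, (↑u⁻¹ : Matrix n n R).submatrix e e, ?_, ?_⟩, rfl⟩
  · rw [Matrix.submatrix_mul_equiv, Units.mul_inv, Matrix.submatrix_one_equiv]
  · rw [Matrix.submatrix_mul_equiv, Units.inv_mul, Matrix.submatrix_one_equiv]

variable {R : Type*} [NormedRing R] [CompleteSpace R]

theorem continuous_ringInverse_matrix {X n : Type*} [Fintype n] [DecidableEq n]
    [TopologicalSpace X] {f : X → Matrix n n R} (hf : Continuous f) (hu : ∀ x, IsUnit (f x)) :
    Continuous fun x => Ring.inverse (f x) := by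
  have hc : CompleteSpace (Matrix n n R) := inferInstance
  let : NormedRing (Matrix n n R) := Matrix.linftyOpNormedRing
  have : @CompleteSpace (Matrix n n R) (Matrix.linftyOpNormedRing.toUniformSpace) := hc
  refine continuous_iff_continuousAt.2 fun x => ?_
  obtain ⟨u, hu⟩ := hu x
  have := NormedRing.inverse_continuousAt u
  rw [hu] at this
  exact this.comp hf.continuousAt

variable [NormedAlgebra ℂ R]

theorem joinedIn_of_fromBlocks_unit (hd : Dense {r : R | IsUnit r}) {ι : Type*} [Fintype ι]
    [DecidableEq ι] [Nonempty ι] {U : Matrix ι ι R}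
    (h : JoinedIn {M | IsUnit M} (Matrix.fromBlocks U 0 0 (1 : Matrix Unit Unit R)) 1) :
    JoinedIn {M | IsUnit M} U 1 := by
  obtain ⟨γ, hγ⟩ := h
  let l : ι ⊕ Unit := Sum.inr ()
  let P : ℝ → Matrix (ι ⊕ Unit) (ι ⊕ Unit) R := γ.extend
  have hP : Continuous P := γ.continuous_extend
  have hPu : ∀ t, IsUnit (P t) := fun t => hγ _
  have hP0 : P 0 = Matrix.fromBlocks U 0 0 1 := γ.extend_zero
  have hP1 : P 1 = 1 := γ.extend_one
  let Q : ℝ → Matrix (ι ⊕ Unit) (ι ⊕ Unit) R := fun t => Ring.inverse (P t)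
  have hQ : Continuous Q := continuous_ringInverse_matrix hP hPu
  have hPQ : ∀ t, P t * Q t = 1 := fun t => Ring.mul_inverse_cancel _ (hPu t)
  have hQP : ∀ t, Q t * P t = 1 := fun t => Ring.inverse_mul_cancel _ (hPu t)
  have hQ0 : ∀ i, Q 0 i l = Q 1 i l := by
    intro i
    have h1 : Q 1 = 1 := by simpa [hP1] using hQP 1
    have h0 := congrFun (congrFun (hQP 0) i) l
    rw [hP0, Matrix.mul_apply, Fintype.sum_sum_type] at h0
    simpa [l, h1] using h0
  have hP01 : ∀ i, P 0 l i = P 1 l i := by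
    rw [hP0, hP1, ← Matrix.fromBlocks_one]
    rintro (i | i) <;> simp [l]
  have lift : ∀ f : ℝ → R, Continuous f → f 0 = f 1 →
      ∃ g : C(UnitAddCircle, R), ∀ t ∈ Set.Ico (0 : ℝ) 1, g t = f t := fun f hf h01 =>
    ⟨⟨AddCircle.liftIco 1 0 f, AddCircle.liftIco_zero_continuous h01 hf.continuousOn⟩,
      fun t ht => AddCircle.liftIco_zero_coe_apply ht⟩
  choose c hc using fun i => lift (fun t => P t l i) (hP.matrix_elem l i) (hP01 i)
  choose r hr using fun i => lift (fun t => Q t i l) (hQ.matrix_elem i l) (hQ0 i)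
  have hc' : ∀ i, ∀ t ∈ Set.Icc (0 : ℝ) 1, c i t = P t l i := by
    intro i t ht
    rcases eq_or_lt_of_le ht.2 with rfl | h
    · rw [AddCircle.coe_period, ← hP01]
      exact hc i 0 (by simp)
    · exact hc i t ⟨ht.1, h⟩
  have hcr : c ⬝ᵥ r = 1 := by
    ext x
    obtain ⟨t, ht, rfl⟩ := AddCircle.eq_coe_Ico x
    rw [dotProduct, ContinuousMap.sum_apply]
    simp only [ContinuousMap.mul_apply, hc _ t ht, hr _ t ht]
    have := congrFun (congrFun (hPQ t) l) l
    simpa [Matrix.mul_apply] using this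
  obtain ⟨i₀⟩ := ‹Nonempty ι›
  have hop : IsOpen {c' : ι ⊕ Unit → C(UnitAddCircle, R) | IsUnit (c' ⬝ᵥ r)} :=
    Units.isOpen.preimage (f := fun c' => c' ⬝ᵥ r) (continuous_id.dotProduct continuous_const)
  obtain ⟨c', hc'u, E, hE, hcE⟩ := (CircleAlgebra.dense_reducible hd (l := l)
    (Sum.inl_ne_inr (a := i₀) (b := ()))).inter_open_nonempty _ hop ⟨c, by simp [hcr]⟩
  obtain ⟨G, hG, hcG⟩ := RowReduction.exists_isUnit_vecMul_eq hcr hc'u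
  let ev : UnitAddCircle → C(UnitAddCircle, R) →+* R := fun x =>
    { toFun := fun f => f x
      map_one' := rfl
      map_mul' := fun _ _ => rfl
      map_zero' := rfl
      map_add' := fun _ _ => rfl }
  have hF : Matrix.vecMul c (G * E) = Pi.single l 1 := by rw [← Matrix.vecMul_vecMul, hcG, hcE]
  let F : UnitAddCircle → Matrix (ι ⊕ Unit) (ι ⊕ Unit) R := fun x => (ev x).mapMatrix (G * E)
  have hFc : Continuous F := continuous_matrix fun i j => ((G * E) i j).continuous
  have hFu : ∀ x, IsUnit (F x) := fun x => (hG.mul hE).map (ev x).mapMatrix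
  let M : ℝ → Matrix (ι ⊕ Unit) (ι ⊕ Unit) R := fun t => P t * F t
  have hMc : Continuous M := hP.matrix_mul (hFc.comp (AddCircle.continuous_mk' 1))
  have hMl : ∀ t ∈ Set.Icc (0 : ℝ) 1, ∀ j, M t l j = (1 : Matrix (ι ⊕ Unit) (ι ⊕ Unit) R) l j := by
    intro t ht j
    have := congrArg (ev t) (congrFun hF j)
    rw [Matrix.vecMul, dotProduct, map_sum] at this
    simp only [map_mul] at this
    change (P t * F t) l j = _
    rw [Matrix.mul_apply]
    refine Eq.trans (Finset.sum_congr rfl fun i _ => ?_) (this.trans ?_)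
    · rw [← hc' i t ht]; rfl
    · simp only [Pi.single_apply, Matrix.one_apply, eq_comm (a := j)]
      split_ifs <;> simp
  have hα : ∀ t ∈ Set.Icc (0 : ℝ) 1, IsUnit (M t).toBlocks₁₁ := by
    intro t ht
    refine isUnit_toBlocks₁₁ ((hPu t).mul (hFu t)) ?_ ?_
    · ext i j; simpa [Matrix.toBlocks₂₁, l] using hMl t ht (Sum.inl j)
    · ext i j; simpa [Matrix.toBlocks₂₂, l] using hMl t ht (Sum.inr j)
  obtain ⟨a, ha⟩ := hα 1 (by simp)
  have h0 : (M 0).toBlocks₁₁ = U * a := by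
    have : M 1 = F 0 := by simp [M, hP1, AddCircle.coe_period]
    rw [ha, this]
    have h : M 0 = Matrix.fromBlocks U 0 0 1 * F 0 := by simp [M, hP0]
    rw [h, ← Matrix.fromBlocks_toBlocks (F 0), Matrix.fromBlocks_multiply]
    simp
  refine JoinedIn.ofLine (f := fun t => (M t).toBlocks₁₁ * (↑a⁻¹ : Matrix ι ι R)) ?_ ?_ ?_ ?_
  · exact ((hMc.matrix_submatrix Sum.inl Sum.inl).matrix_mul continuous_const).continuousOn
  · rw [h0, mul_assoc, Units.mul_inv, mul_one]
  · rw [← ha, Units.mul_inv]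
  · rintro _ ⟨t, ht, rfl⟩
    exact (hα t ht).mul a⁻¹.isUnit

theorem joinedIn_of_fromBlocks_fin (hd : Dense {r : R | IsUnit r}) {ι : Type*} [Fintype ι]
    [DecidableEq ι] [Nonempty ι] {U : Matrix ι ι R} (k : ℕ)
    (h : JoinedIn {M | IsUnit M} (Matrix.fromBlocks U 0 0 (1 : Matrix (Fin k) (Fin k) R)) 1) :
    JoinedIn {M | IsUnit M} U 1 := by
  induction k with
  | zero =>
    have := joinedIn_isUnit_submatrix (Equiv.sumEmpty ι (Fin 0)).symm h
    rw [Matrix.submatrix_one_equiv] at this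
    convert this using 1
    ext i j
    simp
  | succ k ih =>
    refine ih (joinedIn_of_fromBlocks_unit hd ?_)
    let e : (ι ⊕ Fin k) ⊕ Unit ≃ ι ⊕ Fin (k + 1) :=
      (Equiv.sumAssoc ι (Fin k) Unit).trans (Equiv.sumCongr (Equiv.refl ι)
        ((finSuccEquivLast.trans (Equiv.optionEquivSumPUnit (Fin k))).symm))
    have := joinedIn_isUnit_submatrix e h
    rw [Matrix.submatrix_one_equiv] at this
    convert this using 1
    ext ((i | i) | i) ((j | j) | j) <;> simp [e, Matrix.one_apply, Fin.ext_iff] <;> omega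

/-- Stable homotopy of invertible matrices over a Banach algebra with dense invertibles
is homotopy. -/
theorem joinedIn_of_fromBlocks (hd : Dense {r : R | IsUnit r}) {ι κ : Type*} [Fintype ι]
    [DecidableEq ι] [Nonempty ι] [Fintype κ] [DecidableEq κ] {U : Matrix ι ι R}
    (h : JoinedIn {M | IsUnit M} (Matrix.fromBlocks U 0 0 (1 : Matrix κ κ R)) 1) :
    JoinedIn {M | IsUnit M} U 1 := by
  have := joinedIn_isUnit_submatrix (Equiv.sumCongr (Equiv.refl ι) (Fintype.equivFin κ).symm) h
  rw [Matrix.submatrix_one_equiv] at this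
  refine joinedIn_of_fromBlocks_fin hd (Fintype.card κ) ?_
  convert this using 1
  ext (i | i) (j | j) <;> simp [Matrix.one_apply]

end StableCancellation

namespace PolarDecomposition

theorem exists_unitary_mul {U : Type*} [CStarAlgebra U] {w h : U} (hw : IsUnit w) (hh : IsUnit h) (hs : IsSelfAdjoint h)
    (hwh : star w * w = h * h) : ∃ u ∈ unitary U, w = u * h := by
  obtain ⟨w, rfl⟩ := hw
  obtain ⟨h, rfl⟩ := hh
  refine ⟨w * ↑h⁻¹, ?_, by simp [mul_assoc]⟩
  have hs' : star (↑h⁻¹ : U) = ↑h⁻¹ := by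
    have := congrArg star (h.mul_inv)
    rw [star_mul, hs.star_eq, star_one] at this
    exact (Units.eq_inv_of_mul_eq_one_right this)
  have h1 : star ((w : U) * ↑h⁻¹) * ((w : U) * ↑h⁻¹) = 1 := by
    rw [star_mul, hs', mul_assoc, ← mul_assoc (star (w : U)), hwh, ← mul_assoc, ← mul_assoc]
    simp
  rw [Unitary.mem_iff]
  refine ⟨h1, ?_⟩
  have hu : IsUnit ((w : U) * ↑h⁻¹) := (w * h⁻¹).isUnit
  obtain ⟨v, hv⟩ := hu
  rw [← hv] at h1 ⊢
  rw [show star (v : U) = ↑v⁻¹ from Units.eq_inv_of_mul_eq_one_right h1, Units.mul_inv]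

variable {U : Type*} [CStarAlgebra U] [PartialOrder U] [StarOrderedRing U]

theorem isStrictlyPositive_convex {a b : U} (ha : IsStrictlyPositive a)
    (hb : IsStrictlyPositive b) {t : ℝ} (ht : t ∈ Set.Icc (0 : ℝ) 1) :
    IsStrictlyPositive ((1 - t) • a + t • b) := by
  rcases eq_or_lt_of_le ht.1 with rfl | h
  · simpa using ha
  · exact IsStrictlyPositive.nonneg_add (smul_nonneg (by linarith [ht.2]) ha.nonneg)
      (hb.smul h)

theorem isStrictlyPositive_sqrt_star_mul_self {w : U} (hw : IsUnit w) :
    IsStrictlyPositive (CFC.sqrt (star w * w)) := by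
  have : IsStrictlyPositive (star w * w) := by
    rw [IsStrictlyPositive.iff_of_unital]
    exact ⟨star_mul_self_nonneg w, hw.star.mul hw⟩
  exact this.sqrt

theorem exists_unitary_mul_sqrt {w : U} (hw : IsUnit w) :
    ∃ u ∈ unitary U, w = u * CFC.sqrt (star w * w) := by
  refine exists_unitary_mul hw (isStrictlyPositive_sqrt_star_mul_self hw).isUnit
    (CFC.sqrt_nonneg _).isSelfAdjoint (CFC.sqrt_mul_sqrt_self _ (star_mul_self_nonneg w)).symm

theorem joinedIn_one {w : U}
    (hu : ∀ u ∈ unitary U, JoinedIn {x : U | IsUnit x} u 1) (hw : IsUnit w) :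
    JoinedIn {x : U | IsUnit x} w 1 := by
  obtain ⟨u, huu, h⟩ := exists_unitary_mul_sqrt hw
  have hp := isStrictlyPositive_sqrt_star_mul_self hw
  refine JoinedIn.trans (JoinedIn.ofLine
    (f := fun t : ℝ => u * ((1 - t) • CFC.sqrt (star w * w) + t • 1)) ?_ ?_ ?_ ?_) (hu u huu)
  · fun_prop
  · simpa using h.symm
  · simp
  · rintro _ ⟨t, ht, rfl⟩
    have : IsUnit u := ⟨Unitary.toUnits ⟨u, huu⟩, rfl⟩
    exact this.mul
      (isStrictlyPositive_convex hp isStrictlyPositive_one ht).isUnit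

end PolarDecomposition

namespace StableCancellation

theorem joinedIn_one_of_joined_unitary {R : Type*} [CStarAlgebra R]
    (hd : Dense {r : R | IsUnit r}) {u : R} {k : ℕ}
    (h : Matrix.fromBlocks (Matrix.of fun _ _ => u) 0 0 (1 : Matrix (Fin k) (Fin k) R) ∈
      unitary (Matrix (Fin 1 ⊕ Fin k) (Fin 1 ⊕ Fin k) R))
    (hj : Joined (1 : unitary (Matrix (Fin 1 ⊕ Fin k) (Fin 1 ⊕ Fin k) R)) ⟨_, h⟩) :
    JoinedIn {r : R | IsUnit r} u 1 := by
  have h1 : JoinedIn {M : Matrix (Fin 1 ⊕ Fin k) (Fin 1 ⊕ Fin k) R | IsUnit M}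
      (Matrix.fromBlocks (Matrix.of fun _ _ => u) 0 0 1) 1 := by
    obtain ⟨γ⟩ := hj.symm
    exact ⟨γ.map continuous_subtype_val, fun t => ⟨Unitary.toUnits (γ t), rfl⟩⟩
  refine ((joinedIn_of_fromBlocks hd h1).map (f := fun M => M 0 0)
    (continuous_id.matrix_elem 0 0)).mono ?_
  rintro _ ⟨_, ⟨v, rfl⟩, rfl⟩
  refine ⟨⟨(v : Matrix (Fin 1) (Fin 1) R) 0 0, (↑v⁻¹ : Matrix (Fin 1) (Fin 1) R) 0 0, ?_, ?_⟩, rfl⟩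
  · simpa [Matrix.mul_apply] using congrFun (congrFun v.mul_inv 0) 0
  · simpa [Matrix.mul_apply] using congrFun (congrFun v.inv_mul 0) 0

end StableCancellation

namespace BlockSwap

theorem isUnit_one_add_mul_swap {R : Type*} [Ring R] {x y : R} (h : IsUnit (1 + x * y)) :
    IsUnit (1 + y * x) := by
  obtain ⟨u, hu⟩ := h
  have h1 : (1 + x * y) * ↑u⁻¹ = 1 := by rw [← hu, Units.mul_inv]
  have h2 : ↑u⁻¹ * (1 + x * y) = 1 := by rw [← hu, Units.inv_mul]
  refine ⟨⟨1 + y * x, 1 - y * ↑u⁻¹ * x, ?_, ?_⟩, rfl⟩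
  · calc (1 + y * x) * (1 - y * ↑u⁻¹ * x) = 1 + y * x - y * ((1 + x * y) * ↑u⁻¹) * x := by
          noncomm_ring
      _ = 1 := by rw [h1]; noncomm_ring
  · calc (1 - y * ↑u⁻¹ * x) * (1 + y * x) = 1 + y * x - y * (↑u⁻¹ * (1 + x * y)) * x := by
          noncomm_ring
      _ = 1 := by rw [h2]; noncomm_ring

variable {R m n : Type*} [Ring R] [Fintype m] [DecidableEq m] [Fintype n] [DecidableEq n]

theorem isUnit_fromBlocks_upper (x : Matrix m n R) :
    IsUnit (Matrix.fromBlocks (1 : Matrix m m R) x 0 (1 : Matrix n n R)) := by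
  refine ⟨⟨Matrix.fromBlocks 1 x 0 1, Matrix.fromBlocks 1 (-x) 0 1, ?_, ?_⟩, rfl⟩ <;>
  simp [Matrix.fromBlocks_multiply, ← Matrix.fromBlocks_one]

theorem isUnit_fromBlocks_lower (y : Matrix n m R) :
    IsUnit (Matrix.fromBlocks (1 : Matrix m m R) 0 y (1 : Matrix n n R)) := by
  refine ⟨⟨Matrix.fromBlocks 1 0 y 1, Matrix.fromBlocks 1 0 (-y) 1, ?_, ?_⟩, rfl⟩ <;>
  simp [Matrix.fromBlocks_multiply, ← Matrix.fromBlocks_one]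

theorem isUnit_fromBlocks_one {M : Matrix m m R} (h : IsUnit M) :
    IsUnit (Matrix.fromBlocks M 0 0 (1 : Matrix n n R)) := by
  obtain ⟨u, rfl⟩ := h
  refine ⟨⟨Matrix.fromBlocks u 0 0 1, Matrix.fromBlocks (↑u⁻¹ : Matrix m m R) 0 0 1, ?_, ?_⟩, rfl⟩ <;>
  simp [Matrix.fromBlocks_multiply, ← Matrix.fromBlocks_one]

theorem isUnit_one_fromBlocks {M : Matrix n n R} (h : IsUnit M) :
    IsUnit (Matrix.fromBlocks (1 : Matrix m m R) 0 0 M) := by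
  obtain ⟨u, rfl⟩ := h
  refine ⟨⟨Matrix.fromBlocks 1 0 0 u, Matrix.fromBlocks 1 0 0 (↑u⁻¹ : Matrix n n R), ?_, ?_⟩,
    rfl⟩ <;>
  simp [Matrix.fromBlocks_multiply, ← Matrix.fromBlocks_one]

variable [Algebra ℂ R] [TopologicalSpace R] [IsTopologicalRing R] [ContinuousSMul ℂ R]

/-- The two diagonal stabilisations of `1 + x * y` and `1 + y * x` are homotopic. -/
theorem joinedIn_fromBlocks_swap (x : Matrix m n R) (y : Matrix n m R)
    (h : IsUnit (1 + x * y)) :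
    JoinedIn {M : Matrix (m ⊕ n) (m ⊕ n) R | IsUnit M}
      (Matrix.fromBlocks (1 + x * y) 0 0 1) (Matrix.fromBlocks 1 0 0 (1 + y * x)) := by
  let E : ℝ → Matrix (m ⊕ n) (m ⊕ n) R := fun t => Matrix.fromBlocks 1 (-((t : ℂ) • x)) 0 1
  let F : ℝ → Matrix (m ⊕ n) (m ⊕ n) R := fun t => Matrix.fromBlocks 1 0 ((t : ℂ) • y) 1
  have hEc : Continuous E := by
    refine Continuous.matrix_fromBlocks ?_ ?_ ?_ ?_ <;> fun_prop
  have hFc : Continuous F := by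
    refine Continuous.matrix_fromBlocks ?_ ?_ ?_ ?_ <;> fun_prop
  have hE : ∀ t, IsUnit (E t) := fun t => isUnit_fromBlocks_upper _
  have hF : ∀ t, IsUnit (F t) := fun t => isUnit_fromBlocks_lower _
  set D : Matrix (m ⊕ n) (m ⊕ n) R := Matrix.fromBlocks (1 + x * y) 0 0 1 with hD
  set D' : Matrix (m ⊕ n) (m ⊕ n) R := Matrix.fromBlocks 1 0 0 (1 + y * x) with hD'
  have hE0 : E 0 = 1 := by simp [E]
  have hF0 : F 0 = 1 := by simp [F]
  have key : E 1 * D * F 1 = F 1 * D' * E 1 := by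
    simp [E, F, D, D', Matrix.fromBlocks_multiply]
  have hDu : IsUnit D := isUnit_fromBlocks_one h
  have hDu' : IsUnit D' := by
    have := ((hE 1).mul hDu).mul (hF 1)
    rw [key] at this
    obtain ⟨a, ha⟩ := hF 1
    obtain ⟨b, hb⟩ := hE 1
    rw [← ha, ← hb] at this
    simpa using this
  refine JoinedIn.trans (y := E 1 * D * F 1) ?_ (JoinedIn.symm ?_)
  · refine JoinedIn.ofLine (f := fun t => E t * D * F t) ?_ (by simp [hE0, hF0]) rfl ?_
    · exact ((hEc.matrix_mul continuous_const).matrix_mul hFc).continuousOn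
    · rintro _ ⟨t, -, rfl⟩
      exact ((hE t).mul hDu).mul (hF t)
  · rw [key]
    refine JoinedIn.ofLine (f := fun t => F t * D' * E t) ?_ (by simp [hE0, hF0]) rfl ?_
    · exact ((hFc.matrix_mul continuous_const).matrix_mul hEc).continuousOn
    · rintro _ ⟨t, -, rfl⟩
      exact ((hF t).mul hDu').mul (hE t)

end BlockSwap

namespace CharacterAlgebra

variable {U : Type*} [CStarAlgebra U] (ρ : U →⋆ₐ[ℂ] ℂ) (q : U)

/-- The elements acting on `q` from the left through the character `ρ`. -/
def eigenAlgebra : Subalgebra ℂ U where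
  carrier := {x | x * q = ρ x • q}
  mul_mem' {x y} hx hy := by
    simp only [Set.mem_ofPred_eq] at hx hy ⊢
    rw [mul_assoc, hy, mul_smul_comm, hx, smul_smul, map_mul, mul_comm]
  add_mem' {x y} hx hy := by
    simp only [Set.mem_ofPred_eq] at hx hy ⊢
    rw [add_mul, hx, hy, map_add, add_smul]
  algebraMap_mem' c := by
    simp [Algebra.algebraMap_eq_smul_one]

variable {ρ q}

theorem mem_eigenAlgebra {x : U} : x ∈ eigenAlgebra ρ q ↔ x * q = ρ x • q := Iff.rfl

theorem mem_eigenAlgebra_of_zero {x : U} (h : x * q = 0) (h' : ρ x = 0) :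
    x ∈ eigenAlgebra ρ q := by
  rw [mem_eigenAlgebra, h, h', zero_smul]

theorem isClosed_eigenAlgebra : IsClosed (eigenAlgebra ρ q : Set U) := by
  have hρ : Continuous ρ := map_continuous ρ
  exact isClosed_eq (by fun_prop) (by fun_prop)

instance : CompleteSpace (eigenAlgebra ρ q) :=
  isClosed_eigenAlgebra.completeSpace_coe

theorem isUnit_coe_iff {x : eigenAlgebra ρ q} : IsUnit (x : U) ↔ IsUnit x := by
  refine ⟨fun ⟨u, hu⟩ => ?_, fun h => h.map (eigenAlgebra ρ q).val⟩
  have h1 : ρ ↑u⁻¹ * ρ u = 1 := by rw [← map_mul, Units.inv_mul, map_one]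
  have h2 : (↑u⁻¹ : U) ∈ eigenAlgebra ρ q := by
    have hx : (u : U) * q = ρ u • q := hu ▸ x.2
    rw [mem_eigenAlgebra]
    calc (↑u⁻¹ : U) * q = (↑u⁻¹ : U) * ((ρ ↑u⁻¹ * ρ u) • q) := by rw [h1, one_smul]
      _ = (↑u⁻¹ : U) * (ρ ↑u⁻¹ • ((u : U) * q)) := by rw [mul_smul, hx]
      _ = ρ ↑u⁻¹ • q := by rw [mul_smul_comm, ← mul_assoc, Units.inv_mul, one_mul]
  refine ⟨⟨x, ⟨_, h2⟩, Subtype.ext ?_, Subtype.ext ?_⟩, rfl⟩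
  · simp [← hu]
  · simp [← hu]

variable [PartialOrder U] [StarOrderedRing U]

theorem exists_right_approx_unit {l : U} (hl : l * q = 0) (hl' : ρ l = 0) {ε : ℝ} (hε : 0 < ε) :
    ∃ h : U, 0 ≤ h ∧ h * q = 0 ∧ ρ h = 0 ∧ ‖l - l * h‖ < ε := by
  set a := star l * l with ha
  have ha0 : 0 ≤ a := star_mul_self_nonneg l
  set δ : ℝ := ε ^ 2 / 2 with hδ
  have hδ0 : 0 < δ := by positivity
  have hsp : ∀ x ∈ spectrum ℝ a, 0 ≤ x := spectrum_nonneg_of_nonneg ha0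
  have hm : ∀ t : ℝ, 0 < max t δ := fun t => lt_max_of_lt_right hδ0
  have hc : Continuous fun t : ℝ => (max t δ)⁻¹ :=
    (continuous_id.max continuous_const).inv₀ fun t => (hm t).ne'
  set h : U := cfc (fun t : ℝ => (max t δ)⁻¹ * t) a with hh
  have hg : h = cfc (fun t : ℝ => (max t δ)⁻¹) a * a := by
    rw [hh, cfc_mul _ (fun t => t) a hc.continuousOn continuousOn_id, cfc_id' ℝ a]
  have hpos : 0 ≤ h := cfc_nonneg fun x hx => mul_nonneg (inv_nonneg.2 (hm x).le) (hsp x hx)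
  refine ⟨h, hpos, ?_, ?_, ?_⟩
  · rw [hg, ha, mul_assoc, mul_assoc, hl, mul_zero, mul_zero]
  · rw [hg, ha, map_mul, map_mul, hl', mul_zero, mul_zero]
  · have h1 : star (l - l * h) * (l - l * h) =
        cfc (fun t : ℝ => (1 - (max t δ)⁻¹ * t) * t * (1 - (max t δ)⁻¹ * t)) a := by
      have hk : cfc (fun t : ℝ => 1 - (max t δ)⁻¹ * t) a = 1 - h := by
        rw [cfc_sub _ (fun t => (max t δ)⁻¹ * t) a continuousOn_const (hc.mul continuous_id).continuousOn,
          cfc_const_one ℝ a]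
      have hc' : Continuous fun t : ℝ => 1 - (max t δ)⁻¹ * t :=
        continuous_const.sub (hc.mul continuous_id)
      rw [cfc_mul (fun t => (1 - (max t δ)⁻¹ * t) * t) (fun t => 1 - (max t δ)⁻¹ * t) a
          (hc'.mul continuous_id).continuousOn hc'.continuousOn,
        cfc_mul _ (fun t => t) a hc'.continuousOn continuousOn_id, cfc_id' ℝ a, hk, ha]
      have : l - l * h = l * (1 - h) := by rw [mul_sub, mul_one]
      rw [this, star_mul, star_sub, star_one, hpos.isSelfAdjoint.star_eq]
      simp only [mul_assoc]
    have h2 : ‖l - l * h‖ * ‖l - l * h‖ ≤ δ := by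
      rw [← CStarRing.norm_star_mul_self, h1]
      refine norm_cfc_le hδ0.le fun t ht => ?_
      have ht0 := hsp t ht
      rcases le_total δ t with h | h
      · rw [max_eq_left h, inv_mul_cancel₀ (hδ0.trans_le h).ne']
        simp [hδ0.le]
      · rw [max_eq_right h]
        have h3 : 0 ≤ δ⁻¹ * t := by positivity
        have h4 : δ⁻¹ * t ≤ 1 := by
          rw [inv_mul_le_iff₀ hδ0]; linarith
        rw [Real.norm_of_nonneg (mul_nonneg (mul_nonneg (by linarith) ht0) (by linarith))]
        calc (1 - δ⁻¹ * t) * t * (1 - δ⁻¹ * t) ≤ 1 * δ * 1 := by gcongr <;> linarith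
          _ = δ := by ring
    by_contra! hcon
    have : ε * ε ≤ δ := (mul_le_mul hcon hcon hε.le (norm_nonneg _)).trans h2
    rw [hδ] at this
    nlinarith

theorem dense_isUnit (hd : Dense {x : U | IsUnit x}) :
    Dense {x : eigenAlgebra ρ q | IsUnit x} := by
  have main : ∀ l : U, l * q = 0 → ρ l = 0 → ∀ ε > 0, ∃ y : eigenAlgebra ρ q,
      IsUnit y ∧ ‖(y : U) - (1 + l)‖ < ε := by
    intro l hl hl' ε hε
    obtain ⟨h, hpos, hq, hρ, hlh⟩ := exists_right_approx_unit hl hl' hε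
    have hcont : ContinuousAt (fun p : ℝ × U => Ring.inverse (1 + p.1 • p.2) * p.2 * h) (0, l) := by
      refine ContinuousAt.mul (ContinuousAt.mul ?_ continuousAt_snd) continuousAt_const
      refine ContinuousAt.comp' ?_ (by fun_prop)
      simpa using NormedRing.inverse_continuousAt (1 : Uˣ)
    have h0 : Ring.inverse (1 + (0 : ℝ) • l) * l * h = l * h := by simp
    have ev1 : ∀ᶠ p : ℝ × U in nhds (0, l),
        ‖Ring.inverse (1 + p.1 • p.2) * p.2 * h - l‖ < ε := by
      have : ContinuousAt (fun p : ℝ × U => ‖Ring.inverse (1 + p.1 • p.2) * p.2 * h - l‖) (0, l) :=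
        (hcont.sub continuousAt_const).norm
      refine this.eventually_lt_const ?_
      simp only [h0]
      rwa [norm_sub_rev]
    have ev2 : ∀ᶠ p : ℝ × U in nhds (0, l), IsUnit (1 + p.1 • p.2) := by
      have : ContinuousAt (fun p : ℝ × U => 1 + p.1 • p.2) (0, l) := by fun_prop
      exact this.eventually (Units.isOpen.mem_nhds (by simp))
    obtain ⟨pa, hpa, pb, hpb, hp⟩ := Filter.eventually_prod_iff.1
      (nhds_prod_eq (x := (0 : ℝ)) (y := l) ▸ ev1.and ev2)
    obtain ⟨s, hs, hs0⟩ : ∃ s : ℝ, pa s ∧ 0 < s := by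
      have := (hpa.filter_mono nhdsWithin_le_nhds).and
        (self_mem_nhdsWithin : Set.Ioi (0 : ℝ) ∈ nhdsWithin 0 (Set.Ioi 0))
      exact this.exists
    have hdpos : IsStrictlyPositive (h + s • (1 : U)) :=
      IsStrictlyPositive.nonneg_add hpos (isStrictlyPositive_one.smul hs0)
    obtain ⟨d, hdd⟩ := hdpos.isUnit
    have hsub : Filter.Tendsto (fun y : U => y - ↑d⁻¹) (nhds (l + ↑d⁻¹)) (nhds l) := by
      have : Continuous fun y : U => y - ↑d⁻¹ := by fun_prop
      simpa using this.tendsto (l + ↑d⁻¹)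
    obtain ⟨y, hyu, hyb⟩ := ((mem_closure_iff_frequently.1 (hd (l + ↑d⁻¹))).and_eventually
      (hsub.eventually hpb)).exists
    set a := y - ↑d⁻¹ with ha
    obtain ⟨hclose, v, hv⟩ := hp hs hyb
    simp only at hclose hv
    rw [← hv, Ring.inverse_unit] at hclose
    have hprod : y * d = v * (1 + ↑v⁻¹ * a * h) := by
      have : y = a + ↑d⁻¹ := by rw [ha]; abel
      rw [mul_add, ← mul_assoc, ← mul_assoc, Units.mul_inv, mul_one, one_mul, hv, this, add_mul,
        Units.inv_mul, hdd, mul_add, mul_smul_comm, mul_one]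
      abel
    have hz : (1 + ↑v⁻¹ * a * h) ∈ eigenAlgebra ρ q :=
      add_mem (one_mem _) (mem_eigenAlgebra_of_zero (by rw [mul_assoc, hq, mul_zero])
        (by rw [map_mul, hρ, mul_zero]))
    refine ⟨⟨_, hz⟩, ?_, ?_⟩
    · rw [← isUnit_coe_iff]
      have : IsUnit (y * (d : U)) := IsUnit.mul hyu d.isUnit
      rw [hprod] at this
      simpa using this
    · simpa using hclose
  refine Metric.dense_iff.2 fun x r hr => ?_
  obtain ⟨c, hc, hcr⟩ : ∃ c : ℂ, c ≠ 0 ∧ ‖c - ρ x‖ < r / 2 := by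
    have h1 : Dense ({0}ᶜ : Set ℂ) := dense_compl_singleton 0
    obtain ⟨c, hc, hcd⟩ := Metric.dense_iff.1 h1 (ρ x) (r / 2) (by positivity)
    exact ⟨c, hcd, by simpa [dist_eq_norm] using hc⟩
  have hcn : 0 < ‖c‖ := norm_pos_iff.2 hc
  set l : U := c⁻¹ • ((x : U) - algebraMap ℂ U (ρ x)) with hl
  have hlq : l * q = 0 := by
    have := x.2
    rw [mem_eigenAlgebra] at this
    rw [hl, smul_mul_assoc, sub_mul, this, Algebra.algebraMap_eq_smul_one, smul_mul_assoc, one_mul,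
      sub_self, smul_zero]
  have hlρ : ρ l = 0 := by
    rw [hl, map_smul, map_sub, AlgHomClass.commutes ρ]
    simp
  obtain ⟨y, hyu, hy⟩ := main l hlq hlρ (r / 2 / ‖c‖) (by positivity)
  have hcx : c • (1 + l) - x = algebraMap ℂ U (c - ρ x) := by
    rw [hl, smul_add, smul_smul, mul_inv_cancel₀ hc, one_smul, map_sub,
      Algebra.algebraMap_eq_smul_one c]
    abel
  refine ⟨c • y, ?_, ?_⟩
  · rw [Metric.mem_ball, dist_eq_norm]
    change ‖c • (y : U) - x‖ < r
    have h1 : c • (y : U) - x = c • ((y : U) - (1 + l)) + algebraMap ℂ U (c - ρ x) := by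
      rw [← hcx, smul_sub]; abel
    rw [h1]
    refine (norm_add_le _ _).trans_lt ?_
    have h2 : ‖c • ((y : U) - (1 + l))‖ < r / 2 := by
      rw [norm_smul]
      calc ‖c‖ * _ < ‖c‖ * (r / 2 / ‖c‖) := by gcongr
        _ = r / 2 := by field_simp
    have h3 : ‖algebraMap ℂ U (c - ρ x)‖ < r / 2 := by
      have : Nontrivial U := (ρ : U →+* ℂ).domain_nontrivial
      rwa [norm_algebraMap, CStarRing.norm_one, mul_one]
    linarith
  · exact (IsUnit.smul (Units.mk0 c hc) hyu :)

end CharacterAlgebra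

namespace CharacterAlgebra

variable {U : Type*} [CStarAlgebra U] {ρ : U →⋆ₐ[ℂ] ℂ} {q : U}

theorem exists_sum_approx
    (hideal : ∀ I : TwoSidedIdeal U, IsClosed (I : Set U) → (∃ x ∈ I, ρ x = 0 ∧ x ≠ 0) →
      ∀ x, ρ x = 0 → x ∈ I)
    {l : U} (hl : l * q = 0) (hl' : ρ l = 0) (hl0 : l ≠ 0) {e : U} (he : ρ e = 0) {ε : ℝ}
    (hε : 0 < ε) :
    ∃ (n : ℕ) (l' z : Fin n → U), (∀ i, l' i * q = 0 ∧ ρ (l' i) = 0) ∧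
      ‖∑ i, l' i * z i - e‖ < ε := by
  let J : Set U := {x | ∃ (n : ℕ) (l' z : Fin n → U), (∀ i, l' i * q = 0 ∧ ρ (l' i) = 0) ∧
    x = ∑ i, l' i * z i}
  have hneg : ∀ x ∈ J, -x ∈ J := by
    rintro _ ⟨n, l', z, h, rfl⟩
    exact ⟨n, l', -z, h, by simp⟩
  have hleft : ∀ a, ∀ x ∈ J, a * x ∈ J := by
    rintro a _ ⟨n, l', z, h, rfl⟩
    refine ⟨n, fun i => a * l' i, z, fun i => ⟨?_, ?_⟩, ?_⟩
    · rw [mul_assoc, (h i).1, mul_zero]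
    · rw [map_mul, (h i).2, mul_zero]
    · simp only [Finset.mul_sum, mul_assoc]
  have hright : ∀ a, ∀ x ∈ J, x * a ∈ J := by
    rintro a _ ⟨n, l', z, h, rfl⟩
    exact ⟨n, l', fun i => z i * a, h, by simp only [Finset.sum_mul, mul_assoc]⟩
  have hadd : ∀ x ∈ J, ∀ y ∈ J, x + y ∈ J := by
    rintro _ ⟨n, l', z, h, rfl⟩ _ ⟨n', l'', z', h', rfl⟩
    refine ⟨n + n', Fin.append l' l'', Fin.append z z', fun i => ?_, ?_⟩
    · refine Fin.addCases (fun i => ?_) (fun i => ?_) i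
      · simpa using h i
      · simpa using h' i
    · simp [Fin.sum_univ_add]
  have hzero : (0 : U) ∈ J := ⟨0, Fin.elim0, Fin.elim0, fun i => i.elim0, by simp⟩
  let I : TwoSidedIdeal U := TwoSidedIdeal.mk' (closure J) (subset_closure hzero)
    (fun hx hy => map_mem_closure₂ continuous_add hx hy hadd)
    (fun hx => map_mem_closure continuous_neg hx hneg)
    (fun {a _} hx => map_mem_closure (continuous_const_mul a) hx (hleft a))
    (fun {_ a} hx => map_mem_closure (f := (· * a)) (continuous_mul_const a) hx (hright a))
  have hI : ∀ x, x ∈ I ↔ x ∈ closure J := fun x => TwoSidedIdeal.mem_mk' _ _ _ _ _ _ _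
  have hIc : IsClosed (I : Set U) := by
    have : (I : Set U) = closure J := Set.ext hI
    rw [this]
    exact isClosed_closure
  have hlJ : l ∈ J := ⟨1, fun _ => l, fun _ => 1, fun _ => ⟨hl, hl'⟩, by simp⟩
  have heI := (hI e).1 (hideal I hIc ⟨l, (hI l).2 (subset_closure hlJ), hl', hl0⟩ e he)
  obtain ⟨_, ⟨n, l', z, h, rfl⟩, hx⟩ := Metric.mem_closure_iff.1 heI ε hε
  refine ⟨n, l', z, h, ?_⟩
  rwa [norm_sub_rev, ← dist_eq_norm]

theorem isUnit_one_add_of {ι : Type*} [Fintype ι] [DecidableEq ι]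
    {l z : ι → U} {θ : U → Matrix ι ι (eigenAlgebra ρ q)}
    (hθ : ∀ x i j, (θ x i j : U) = z i * x * l j) {x : U}
    (hx : IsUnit (1 + x * ∑ i, l i * z i)) : IsUnit (1 + θ x) := by
  set s := ∑ i, l i * z i with hs
  have hmul : ∀ x y, θ x * θ y = θ (x * s * y) := by
    intro x y
    ext i j
    rw [Matrix.mul_apply, AddSubmonoidClass.coe_finsetSum, hθ, hs]
    simp only [MulMemClass.coe_mul, hθ, Finset.mul_sum, Finset.sum_mul, mul_assoc]
  have hadd : ∀ x y, θ (x + y) = θ x + θ y := by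
    intro x y
    ext i j
    simp [hθ, mul_add, add_mul]
  have hsub : ∀ x y, θ (x - y) = θ x - θ y := by
    intro x y
    ext i j
    simp [hθ, mul_sub, sub_mul]
  have h0 : θ 0 = 0 := by
    ext i j
    simp [hθ]
  obtain ⟨b, hb⟩ := hx
  have h1 : (1 + x * s) * (↑b⁻¹ : U) = 1 := by rw [← hb, Units.mul_inv]
  have h2 : (↑b⁻¹ : U) * (1 + x * s) = 1 := by rw [← hb, Units.inv_mul]
  refine ⟨⟨1 + θ x, 1 - θ (↑b⁻¹ * x), ?_, ?_⟩, rfl⟩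
  · have : x - ↑b⁻¹ * x - x * s * (↑b⁻¹ * x) = 0 := by
      calc _ = (1 - (1 + x * s) * ↑b⁻¹) * x := by noncomm_ring
        _ = 0 := by rw [h1, sub_self, zero_mul]
    calc _ = 1 + (θ x - θ (↑b⁻¹ * x) - θ x * θ (↑b⁻¹ * x)) := by noncomm_ring
      _ = 1 := by rw [hmul, ← hsub, ← hsub, this, h0, add_zero]
  · have : x - ↑b⁻¹ * x - ↑b⁻¹ * x * s * x = 0 := by
      calc _ = (1 - ↑b⁻¹ * (1 + x * s)) * x := by noncomm_ring
        _ = 0 := by rw [h2, sub_self, zero_mul]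
    calc _ = 1 + (θ x - θ (↑b⁻¹ * x) - θ (↑b⁻¹ * x) * θ x) := by noncomm_ring
      _ = 1 := by rw [hmul, ← hsub, ← hsub, this, h0, add_zero]

theorem joinedIn_of_mem_ball {R : Type*} [NormedRing R] [NormedAlgebra ℂ R] {S : Set R} {x y : R}
    {r : ℝ} (hS : Metric.ball x r ⊆ S) (hy : y ∈ Metric.ball x r) : JoinedIn S x y := by
  have : NormedSpace ℝ R := NormedSpace.restrictScalars ℝ ℂ R
  exact (((convex_ball x r).isPathConnected ⟨y, hy⟩).joinedIn x
    (Metric.mem_ball_self (dist_nonneg.trans_lt hy)) y hy).mono hS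

variable [PartialOrder U] [StarOrderedRing U]

theorem joinedIn_eigenAlgebra_one (hd : Dense {x : U | IsUnit x})
    (hconn : ∀ w : U, IsUnit w → JoinedIn {x : U | IsUnit x} w 1)
    (hideal : ∀ I : TwoSidedIdeal U, IsClosed (I : Set U) → (∃ x ∈ I, ρ x = 0 ∧ x ≠ 0) →
      ∀ x, ρ x = 0 → x ∈ I)
    (happ : ∀ K : Set U, IsCompact K → (∀ x ∈ K, ρ x = 0) → ∀ ε > 0,
      ∃ e, ρ e = 0 ∧ ∀ x ∈ K, ‖x * e - x‖ < ε)
    {w : eigenAlgebra ρ q} (hw : IsUnit w) (hρw : ρ w = 1) :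
    JoinedIn {x : eigenAlgebra ρ q | IsUnit x} w 1 := by
  set l : U := w - 1 with hl
  have hρl : ρ l = 0 := by rw [hl, map_sub, hρw, map_one, sub_self]
  have hlq : l * q = 0 := by
    rw [hl, sub_mul, mem_eigenAlgebra.1 w.2, hρw, one_smul, one_mul, sub_self]
  rcases eq_or_ne l 0 with hl0 | hl0
  · have : w = 1 := Subtype.ext (by simpa [hl, sub_eq_zero] using hl0)
    rw [this]
    exact JoinedIn.refl isUnit_one
  obtain ⟨r, hr, hball⟩ := Metric.isOpen_iff.1 (Units.isOpen (R := eigenAlgebra ρ q)) w hw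
  obtain ⟨h, -, hhq, hρh, hlh⟩ := exists_right_approx_unit hlq hρl (half_pos hr)
  have hmem : ∀ a : U, 1 + a * h ∈ eigenAlgebra ρ q := fun a =>
    add_mem (one_mem _) (mem_eigenAlgebra_of_zero (by rw [mul_assoc, hhq, mul_zero])
      (by rw [map_mul, hρh, mul_zero]))
  have hclose : ∀ a : U, ‖l - a * h‖ < r →
      (⟨_, hmem a⟩ : eigenAlgebra ρ q) ∈ Metric.ball w r := by
    intro a ha
    rw [Metric.mem_ball, dist_comm, dist_eq_norm]
    change ‖(w : U) - (1 + a * h)‖ < r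
    rwa [← sub_sub]
  have hu1 : IsUnit (1 + l * h) :=
    isUnit_coe_iff.2 (hball (hclose l (hlh.trans (half_lt_self hr))))
  obtain ⟨γ, hγ⟩ := hconn _ (BlockSwap.isUnit_one_add_mul_swap hu1)
  have hρc : Continuous ρ := map_continuous ρ
  let p : ℝ → U := γ.extend
  have hpu : ∀ t, IsUnit (p t) := fun t => hγ _
  have hpc : Continuous p := γ.continuous_extend
  have hρp : ∀ t, ρ (p t) ≠ 0 := fun t => ((hpu t).map ρ).ne_zero
  let p' : ℝ → U := fun t => (ρ (p t))⁻¹ • p t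
  have hp'c : Continuous p' := ((hρc.comp hpc).inv₀ hρp).smul hpc
  have hp'u : ∀ t, IsUnit (p' t) := fun t =>
    IsUnit.smul (Units.mk0 _ (inv_ne_zero (hρp t))) (hpu t)
  have hp'0 : p' 0 = 1 + h * l := by simp [p', p, γ.extend_zero, hρl]
  have hp'1 : p' 1 = 1 := by simp [p', p, γ.extend_one]
  have hρp' : ∀ t, ρ (p' t) = 1 := fun t => by simp [p', hρp t]
  let K : Set U := p' '' Set.Icc 0 1
  have hK : IsCompact K := isCompact_Icc.image hp'c
  obtain ⟨δ, hδ, hthick⟩ := hK.exists_thickening_subset_open (Units.isOpen (R := U))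
    (by rintro _ ⟨t, -, rfl⟩; exact hp'u t)
  let K' : Set U := insert l ((fun x => x - 1) '' K)
  have hK' : IsCompact K' := (hK.image (by fun_prop)).insert l
  have hρK' : ∀ x ∈ K', ρ x = 0 := by
    rintro _ (rfl | ⟨_, ⟨t, -, rfl⟩, rfl⟩)
    · exact hρl
    · simp [hρp']
  set η := min δ (r / 2 / (‖h‖ + 1)) with hη
  have hη0 : 0 < η := lt_min hδ (by positivity)
  obtain ⟨e, hρe, he⟩ := happ K' hK' hρK' (η / 2) (half_pos hη0)
  obtain ⟨C, hC0, hC⟩ : ∃ C > 0, ∀ x ∈ K', ‖x‖ ≤ C := hK'.isBounded.exists_pos_norm_le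
  obtain ⟨n, l', z, hl', hs⟩ := exists_sum_approx hideal hlq hρl hl0 hρe
    (show 0 < η / 2 / C by positivity)
  set s := ∑ i, l' i * z i with hsdef
  have hs' : ∀ x ∈ K', ‖x * s - x‖ < η := by
    intro x hx
    have h1 : x * s - x = x * (s - e) + (x * e - x) := by noncomm_ring
    have h2 : ‖x * (s - e)‖ ≤ η / 2 := by
      refine (norm_mul_le _ _).trans ?_
      calc ‖x‖ * ‖s - e‖ ≤ C * (η / 2 / C) := mul_le_mul (hC x hx) hs.le (norm_nonneg _) hC0.le
        _ = η / 2 := by field_simp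
    rw [h1]
    exact (norm_add_le _ _).trans_lt (by linarith [he x hx])
  have hls : ‖l - l * s * h‖ < r := by
    have h1 : l - l * s * h = (l - l * h) - (l * s - l) * h := by noncomm_ring
    have h2 : ‖(l * s - l) * h‖ ≤ r / 2 := by
      refine (norm_mul_le _ _).trans ?_
      calc ‖l * s - l‖ * ‖h‖ ≤ (r / 2 / (‖h‖ + 1)) * (‖h‖ + 1) := by
            refine mul_le_mul ((hs' l (Set.mem_insert _ _)).le.trans (min_le_right _ _))
              (by linarith) (norm_nonneg _) (by positivity)
        _ = r / 2 := by field_simp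
    rw [h1]
    exact (norm_sub_le _ _).trans_lt (by linarith)
  have hright : ∀ (a : U) (j), a * l' j ∈ eigenAlgebra ρ q := fun a j =>
    mem_eigenAlgebra_of_zero (by rw [mul_assoc, (hl' j).1, mul_zero])
      (by rw [map_mul, (hl' j).2, mul_zero])
  let θ : U → Matrix (Fin n) (Fin n) (eigenAlgebra ρ q) := fun x =>
    Matrix.of fun i j => ⟨z i * x * l' j, hright _ j⟩
  have hθ : ∀ x i j, (θ x i j : U) = z i * x * l' j := fun _ _ _ => rfl
  let X : Matrix Unit (Fin n) (eigenAlgebra ρ q) := Matrix.of fun _ j => ⟨l * l' j, hright _ j⟩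
  let Y : Matrix (Fin n) Unit (eigenAlgebra ρ q) := Matrix.of fun i _ =>
    ⟨z i * h, mem_eigenAlgebra_of_zero (by rw [mul_assoc, hhq, mul_zero])
      (by rw [map_mul, hρh, mul_zero])⟩
  have hXY : 1 + X * Y = Matrix.of fun _ _ => ⟨1 + l * s * h, hmem _⟩ := by
    ext i j
    simp [Matrix.mul_apply, X, Y, hsdef, Finset.mul_sum, Finset.sum_mul, mul_assoc]
  have hYX : Y * X = θ (h * l) := by
    ext i j
    simp [Matrix.mul_apply, X, Y, θ, mul_assoc]
  have hw1 : JoinedIn {x : eigenAlgebra ρ q | IsUnit x} w ⟨_, hmem (l * s)⟩ :=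
    joinedIn_of_mem_ball hball (hclose _ hls)
  let ψ : eigenAlgebra ρ q → Matrix Unit Unit (eigenAlgebra ρ q) := fun x => Matrix.of fun _ _ => x
  have hψ : ∀ x, IsUnit x → IsUnit (ψ x) := by
    rintro _ ⟨u, rfl⟩
    refine ⟨⟨ψ u, ψ ↑u⁻¹, ?_, ?_⟩, rfl⟩ <;> ext i j <;> simp [ψ, Matrix.mul_apply]
  have hw2 : JoinedIn {M : Matrix (Unit ⊕ Fin n) (Unit ⊕ Fin n) (eigenAlgebra ρ q) | IsUnit M}
      (Matrix.fromBlocks (ψ w) 0 0 1) (Matrix.fromBlocks (1 + X * Y) 0 0 1) := by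
    rw [hXY]
    refine (hw1.map (f := fun x => Matrix.fromBlocks (ψ x) 0 0 1) ?_).mono ?_
    · refine Continuous.matrix_fromBlocks (continuous_matrix fun _ _ => continuous_id) ?_ ?_ ?_ <;>
      fun_prop
    · rintro _ ⟨x, hx, rfl⟩
      exact BlockSwap.isUnit_fromBlocks_one (hψ x hx)
  have hw3 := BlockSwap.joinedIn_fromBlocks_swap X Y (by rw [hXY]; exact hψ _ hw1.target_mem)
  have hw4 : JoinedIn {M : Matrix (Unit ⊕ Fin n) (Unit ⊕ Fin n) (eigenAlgebra ρ q) | IsUnit M}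
      (Matrix.fromBlocks 1 0 0 (1 + Y * X)) 1 := by
    refine JoinedIn.ofLine (f := fun t => Matrix.fromBlocks 1 0 0 (1 + θ (p' t - 1))) ?_ ?_ ?_ ?_
    · have hθc : Continuous fun t => θ (p' t - 1) :=
        continuous_matrix fun i j => Continuous.subtype_mk (by fun_prop) _
      refine Continuous.continuousOn (Continuous.matrix_fromBlocks ?_ ?_ ?_ ?_) <;> fun_prop
    · simp only [hp'0, hYX, add_sub_cancel_left]
    · have : θ (p' 1 - 1) = 0 := by
        ext i j
        simp [hp'1, hθ]
      simp [this]
    · rintro _ ⟨t, ht, rfl⟩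
      refine BlockSwap.isUnit_one_fromBlocks (isUnit_one_add_of hθ ?_)
      refine hthick (Metric.mem_thickening_iff.2 ⟨p' t, ⟨t, ht, rfl⟩, ?_⟩)
      have h1 := hs' (p' t - 1) (Set.mem_insert_of_mem _ ⟨_, ⟨t, ht, rfl⟩, rfl⟩)
      rw [dist_eq_norm]
      refine lt_of_eq_of_lt ?_ (h1.trans_le (min_le_left _ _))
      rw [← hsdef]
      congr 1
      abel
  have hw5 := StableCancellation.joinedIn_of_fromBlocks (dense_isUnit hd)
    (hw2.trans (hw3.trans hw4))
  refine (hw5.map (f := fun M => M () ()) (continuous_id.matrix_elem () ())).mono ?_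
  rintro _ ⟨_, ⟨v, rfl⟩, rfl⟩
  refine ⟨⟨v.1 () (), v.2 () (), ?_, ?_⟩, rfl⟩
  · simpa [Matrix.mul_apply] using congrFun (congrFun v.val_inv ()) ()
  · simpa [Matrix.mul_apply] using congrFun (congrFun v.inv_val ()) ()

end CharacterAlgebra

namespace CharacterAlgebra

variable {U : Type*} [CStarAlgebra U] {ρ : U →⋆ₐ[ℂ] ℂ} [PartialOrder U] [StarOrderedRing U]

theorem exists_threshold {h : U} (hh : 0 ≤ h) {ε : ℝ} (hε : 0 < ε) :
    ∃ g q : U, ‖g‖ ≤ ε⁻¹ ∧ Commute h g ∧ (1 - h * g) * q = 0 ∧ 0 ≤ q ∧ ‖q - h‖ ≤ ε ∧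
      ∀ s ∈ Set.Icc (0 : ℝ) 1, ‖1 - s • (h * g)‖ ≤ 1 := by
  have hsp : ∀ x ∈ spectrum ℝ h, 0 ≤ x := spectrum_nonneg_of_nonneg hh
  have hm : ∀ t : ℝ, 0 < max t ε := fun t => lt_max_of_lt_right hε
  have hc : Continuous fun t : ℝ => (max t ε)⁻¹ :=
    (continuous_id.max continuous_const).inv₀ fun t => (hm t).ne'
  have hcq : Continuous fun t : ℝ => max (t - ε) 0 := by fun_prop
  set g : U := cfc (fun t : ℝ => (max t ε)⁻¹) h with hg
  set q : U := cfc (fun t : ℝ => max (t - ε) 0) h with hq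
  have hhg : h * g = cfc (fun t : ℝ => t * (max t ε)⁻¹) h := by
    rw [cfc_mul (fun t => t) _ h continuousOn_id hc.continuousOn, cfc_id' ℝ h]
  have hgh : g * h = cfc (fun t : ℝ => (max t ε)⁻¹ * t) h := by
    rw [cfc_mul _ (fun t => t) h hc.continuousOn continuousOn_id, cfc_id' ℝ h]
  have hs : ∀ s : ℝ, 1 - s • (h * g) = cfc (fun t : ℝ => 1 - s * (t * (max t ε)⁻¹)) h := by
    intro s
    rw [cfc_sub _ (fun t : ℝ => s * (t * (max t ε)⁻¹)) h continuousOn_const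
      (continuous_const.mul (continuous_id.mul hc)).continuousOn, cfc_const_one ℝ h, hhg,
      ← cfc_const_mul s (fun t : ℝ => t * (max t ε)⁻¹) h (continuous_id.mul hc).continuousOn]
  refine ⟨g, q, ?_, ?_, ?_, ?_, ?_, ?_⟩
  · refine norm_cfc_le (by positivity) fun t _ => ?_
    rw [Real.norm_of_nonneg (inv_nonneg.2 (hm t).le)]
    exact inv_anti₀ hε (le_max_right _ _)
  · change h * g = g * h
    rw [hhg, hgh]
    simp only [mul_comm]
  · have h1 := hs 1
    simp only [one_smul, one_mul] at h1
    have hc1 : Continuous fun t : ℝ => 1 - t * (max t ε)⁻¹ :=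
      continuous_const.sub (continuous_id.mul hc)
    rw [h1, hq, ← cfc_mul _ _ h hc1.continuousOn hcq.continuousOn, ← cfc_const_zero ℝ h]
    refine cfc_congr fun t _ => ?_
    rcases le_total t ε with h | h
    · simp [h]
    · simp [max_eq_left h, (hε.trans_le h).ne']
  · exact cfc_nonneg fun t _ => le_max_right _ _
  · have : q - h = cfc (fun t : ℝ => max (t - ε) 0 - t) h := by
      rw [cfc_sub _ (fun t => t) h hcq.continuousOn continuousOn_id, cfc_id' ℝ h]
    rw [this]
    refine norm_cfc_le hε.le fun t ht => ?_
    have := hsp t ht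
    rw [Real.norm_eq_abs, abs_le]
    rcases le_total (t - ε) 0 with h | h
    · rw [max_eq_right h]
      constructor <;> linarith
    · rw [max_eq_left h]
      constructor <;> linarith
  · intro s hs01
    rw [hs]
    refine norm_cfc_le zero_le_one fun t ht => ?_
    have ht0 := hsp t ht
    have h1 : 0 ≤ t * (max t ε)⁻¹ := mul_nonneg ht0 (inv_nonneg.2 (hm t).le)
    have h2 : t * (max t ε)⁻¹ ≤ 1 := by
      rw [mul_inv_le_iff₀ (hm t), one_mul]
      exact le_max_left _ _
    have h3 : 0 ≤ s * (t * (max t ε)⁻¹) := mul_nonneg hs01.1 h1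
    have h4 : s * (t * (max t ε)⁻¹) ≤ 1 := mul_le_one₀ hs01.2 h1 h2
    rw [Real.norm_of_nonneg (by linarith)]
    linarith

theorem joinedIn_unitary_mul (hd : Dense {x : U | IsUnit x})
    (hconn : ∀ w : U, IsUnit w → JoinedIn {x : U | IsUnit x} w 1)
    (hideal : ∀ I : TwoSidedIdeal U, IsClosed (I : Set U) → (∃ x ∈ I, ρ x = 0 ∧ x ≠ 0) →
      ∀ x, ρ x = 0 → x ∈ I)
    (happ : ∀ K : Set U, IsCompact K → (∀ x ∈ K, ρ x = 0) → ∀ ε > 0,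
      ∃ e, ρ e = 0 ∧ ∀ x ∈ K, ‖x * e - x‖ < ε)
    {v h : U} (hv : v ∈ unitary U) (hρv : ρ v = 1) (hh : IsStrictlyPositive h) {ε : ℝ}
    (hε : 0 < ε) (hvh : ‖v * h - h‖ < ε) :
    JoinedIn {x : U | IsUnit x ∧ ‖x - h‖ ≤ 5 * ε} (v * h) h := by
  have : Nontrivial U := (ρ : U →+* ℂ).domain_nontrivial
  obtain ⟨g, q, hg, hcomm, hfq, hq, hqh, hs⟩ := exists_threshold hh.nonneg hε
  have hvn : ‖v‖ ≤ 1 := (CStarRing.norm_of_mem_unitary hv).le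
  have hvn' : ‖star v‖ ≤ 1 := by rwa [norm_star]
  have hvu : IsUnit v := ⟨Unitary.toUnits ⟨v, hv⟩, rfl⟩
  set d : U := (v - 1) * (h * g) with hd'
  have hdn : ‖d‖ < 1 := by
    have : d = (v * h - h) * g := by rw [hd']; noncomm_ring
    rw [this]
    calc ‖(v * h - h) * g‖ ≤ ‖v * h - h‖ * ‖g‖ := norm_mul_le _ _
      _ ≤ ‖v * h - h‖ * ε⁻¹ := by gcongr
      _ < ε * ε⁻¹ := by gcongr
      _ = 1 := mul_inv_cancel₀ hε.ne'
  have hvs : ∀ s ∈ Set.Icc (0 : ℝ) 1, IsUnit (v - s • d) := by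
    intro s hs
    have h1 : v - s • d = v * (1 - star v * (s • d)) := by
      rw [mul_sub, mul_one, ← mul_assoc, Unitary.mul_star_self_of_mem hv, one_mul]
    rw [h1]
    refine hvu.mul (isUnit_one_sub_of_norm_lt_one ?_)
    calc ‖star v * (s • d)‖ ≤ ‖star v‖ * ‖s • d‖ := norm_mul_le _ _
      _ ≤ 1 * (1 * ‖d‖) := by
        gcongr
        rw [norm_smul]
        gcongr
        rw [Real.norm_of_nonneg hs.1]
        exact hs.2
      _ < 1 := by simpa using hdn
  have hvsh : ∀ s ∈ Set.Icc (0 : ℝ) 1, ‖(v - s • d) * h - h‖ ≤ ε := by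
    intro s hs'
    have h1 : (v - s • d) * h - h = (v * h - h) * (1 - s • (h * g)) := by
      have : h * g * h = h * (h * g) := by rw [mul_assoc, ← hcomm.eq]
      rw [hd', sub_mul, smul_mul_assoc, mul_assoc (v - 1), this, mul_sub, mul_smul_comm]
      noncomm_ring
    rw [h1]
    calc _ ≤ ‖v * h - h‖ * ‖1 - s • (h * g)‖ := norm_mul_le _ _
      _ ≤ ε * 1 := mul_le_mul hvh.le (hs s hs') (norm_nonneg _) hε.le
      _ = ε := mul_one _
  set w : U := v - d with hw
  have hwu : IsUnit w := by simpa using hvs 1 (by simp)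
  have hwh : ‖w * h - h‖ ≤ ε := by simpa using hvsh 1 (by simp)
  have hwq : w * q = q := by
    have : w = 1 + (v - 1) * (1 - h * g) := by rw [hw, hd']; noncomm_ring
    rw [this, add_mul, mul_assoc, hfq, mul_zero, add_zero, one_mul]
  have hρw : ρ w = 1 := by simp [hw, hd', hρv]
  have hwmem : w ∈ eigenAlgebra ρ q := by rw [mem_eigenAlgebra, hwq, hρw, one_smul]
  have hwn : ‖w‖ ≤ 2 := (norm_sub_le _ _).trans (by linarith)
  obtain ⟨γ, hγ⟩ := joinedIn_eigenAlgebra_one hd hconn hideal happ (w := ⟨w, hwmem⟩)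
    (isUnit_coe_iff.1 hwu) hρw
  have hρc : Continuous ρ := map_continuous ρ
  let p : ℝ → U := fun t => (ρ (γ.extend t))⁻¹ • (γ.extend t : U)
  have hγu : ∀ t, IsUnit (γ.extend t : U) := fun t => isUnit_coe_iff.2 (hγ _)
  have hργ : ∀ t, ρ (γ.extend t) ≠ 0 := fun t => ((hγu t).map ρ).ne_zero
  have hγc : Continuous fun t => (γ.extend t : U) := continuous_subtype_val.comp γ.continuous_extend
  have hpc : Continuous p := ((hρc.comp hγc).inv₀ hργ).smul hγc
  have hpu : ∀ t, IsUnit (p t) := fun t =>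
    IsUnit.smul (Units.mk0 _ (inv_ne_zero (hργ t))) (hγu t)
  have hpq : ∀ t, p t * q = q := by
    intro t
    rw [smul_mul_assoc, mem_eigenAlgebra.1 (γ.extend t).2, smul_smul, inv_mul_cancel₀ (hργ t),
      one_smul]
  have hp0 : p 0 = w := by simp [p, γ.extend_zero, hρw]
  have hp1 : p 1 = 1 := by simp [p, γ.extend_one]
  obtain ⟨C, hC⟩ := (isCompact_Icc (a := (0 : ℝ)) (b := 1)).exists_bound_of_continuousOn
    (f := fun t => p t - 1) (by fun_prop)
  set τ := ε / (|C| + 1) with hτ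
  have hτ0 : 0 < τ := by positivity
  have hτε : τ ≤ ε := div_le_self hε.le (by linarith [abs_nonneg C])
  have hτC : ∀ t ∈ Set.Icc (0 : ℝ) 1, ‖τ • (p t - 1)‖ ≤ ε := by
    intro t ht
    rw [norm_smul, Real.norm_of_nonneg hτ0.le]
    calc τ * ‖p t - 1‖ ≤ τ * (|C| + 1) := by
          gcongr
          linarith [hC t ht, le_abs_self C]
      _ = ε := by rw [hτ]; field_simp
  set h₁ : U := q + τ • (1 : U) with hh₁
  have hh₁p : IsStrictlyPositive h₁ :=
    IsStrictlyPositive.nonneg_add hq (isStrictlyPositive_one.smul hτ0)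
  have hh₁h : ‖h₁ - h‖ ≤ 2 * ε := by
    have : h₁ - h = (q - h) + τ • (1 : U) := by rw [hh₁]; abel
    rw [this]
    refine (norm_add_le _ _).trans ?_
    rw [norm_smul, CStarRing.norm_one, mul_one, Real.norm_of_nonneg hτ0.le]
    linarith
  have J1 : JoinedIn {x : U | IsUnit x ∧ ‖x - h‖ ≤ 5 * ε} (v * h) (w * h) := by
    refine JoinedIn.ofLine (f := fun s : ℝ => (v - s • d) * h) (by fun_prop) (by simp)
      (by simp [hw]) ?_
    rintro _ ⟨s, hs, rfl⟩
    exact ⟨(hvs s hs).mul hh.isUnit, (hvsh s hs).trans (by linarith)⟩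
  have J2 : JoinedIn {x : U | IsUnit x ∧ ‖x - h‖ ≤ 5 * ε} (w * h) (w * h₁) := by
    refine JoinedIn.ofLine (f := fun t : ℝ => w * ((1 - t) • h + t • h₁)) (by fun_prop) (by simp)
      (by simp) ?_
    rintro _ ⟨t, ht, rfl⟩
    refine ⟨hwu.mul (PolarDecomposition.isStrictlyPositive_convex hh hh₁p ht).isUnit, ?_⟩
    have h1 : w * ((1 - t) • h + t • h₁) - h = (w * h - h) + w * (t • (h₁ - h)) := by
      rw [sub_smul, one_smul, smul_sub]
      noncomm_ring
    have h2 : ‖w * (t • (h₁ - h))‖ ≤ 2 * (1 * (2 * ε)) := by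
      refine (norm_mul_le _ _).trans ?_
      rw [norm_smul, Real.norm_of_nonneg ht.1]
      have := ht.2
      gcongr
      exact mul_nonneg ht.1 (norm_nonneg _)
    simp only [h1]
    exact (norm_add_le _ _).trans (by linarith)
  have J3 : JoinedIn {x : U | IsUnit x ∧ ‖x - h‖ ≤ 5 * ε} (w * h₁) h₁ := by
    refine JoinedIn.ofLine (f := fun t : ℝ => p t * h₁) (by fun_prop) (by simp [hp0])
      (by simp [hp1]) ?_
    rintro _ ⟨t, ht, rfl⟩
    refine ⟨(hpu t).mul hh₁p.isUnit, ?_⟩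
    have h1 : p t * h₁ - h = τ • (p t - 1) + (h₁ - h) := by
      rw [hh₁, mul_add, hpq, mul_smul_comm, mul_one, smul_sub]
      abel
    simp only [h1]
    exact (norm_add_le _ _).trans (by linarith [hτC t ht])
  have J4 : JoinedIn {x : U | IsUnit x ∧ ‖x - h‖ ≤ 5 * ε} h₁ h := by
    refine JoinedIn.ofLine (f := fun t : ℝ => (1 - t) • h₁ + t • h) (by fun_prop) (by simp)
      (by simp) ?_
    rintro _ ⟨t, ht, rfl⟩
    refine ⟨(PolarDecomposition.isStrictlyPositive_convex hh₁p hh ht).isUnit, ?_⟩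
    have h1 : (1 - t) • h₁ + t • h - h = (1 - t) • (h₁ - h) := by module
    simp only [h1]
    rw [norm_smul, Real.norm_of_nonneg (by linarith [ht.2])]
    calc (1 - t) * ‖h₁ - h‖ ≤ 1 * (2 * ε) := by
          gcongr
          linarith [ht.1]
      _ ≤ 5 * ε := by linarith
  exact J1.trans (J2.trans (J3.trans J4))

end CharacterAlgebra

namespace PolarDecomposition

variable {U : Type*} [CStarAlgebra U] [PartialOrder U] [StarOrderedRing U]

theorem sqrt_le_sqrt_add {x y : U} (hx : 0 ≤ x) (hy : 0 ≤ y) :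
    CFC.sqrt x ≤ CFC.sqrt y + algebraMap ℝ U √‖x - y‖ := by
  set c := √‖x - y‖ with hc
  have hc0 : 0 ≤ c := Real.sqrt_nonneg _
  have hc0' : 0 ≤ algebraMap ℝ U c := algebraMap_nonneg U hc0
  have hy' := CFC.sqrt_nonneg y
  have hsa : IsSelfAdjoint (x - y) := hx.isSelfAdjoint.sub hy.isSelfAdjoint
  have h1 : x ≤ (CFC.sqrt y + algebraMap ℝ U c) * (CFC.sqrt y + algebraMap ℝ U c) := by
    have h2 : (CFC.sqrt y + algebraMap ℝ U c) * (CFC.sqrt y + algebraMap ℝ U c) =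
        y + algebraMap ℝ U ‖x - y‖ + (2 * c) • CFC.sqrt y := by
      rw [add_mul, mul_add, mul_add, CFC.sqrt_mul_sqrt_self y, ← map_mul,
        Real.mul_self_sqrt (norm_nonneg _), ← Algebra.commutes, ← Algebra.smul_def, mul_smul,
        two_smul]
      abel
    rw [h2]
    have h3 : x ≤ y + algebraMap ℝ U ‖x - y‖ := by
      rw [← sub_le_iff_le_add']
      exact hsa.le_algebraMap_norm_self
    exact h3.trans (le_add_of_nonneg_right (smul_nonneg (by positivity) hy'))
  refine (CFC.sqrt_le_sqrt _ _ h1).trans_eq ?_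
  exact CFC.sqrt_mul_self _ (add_nonneg hy' hc0')

theorem norm_sqrt_sub_sqrt_le {x y : U} (hx : 0 ≤ x) (hy : 0 ≤ y) :
    ‖CFC.sqrt x - CFC.sqrt y‖ ≤ √‖x - y‖ := by
  have h1 := sqrt_le_sqrt_add hx hy
  have h2 := sqrt_le_sqrt_add hy hx
  rw [norm_sub_rev] at h2
  set c := √‖x - y‖ with hc
  have hsa : IsSelfAdjoint (CFC.sqrt x - CFC.sqrt y) :=
    (CFC.sqrt_nonneg x).isSelfAdjoint.sub (CFC.sqrt_nonneg y).isSelfAdjoint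
  rw [← cfc_id' ℝ (CFC.sqrt x - CFC.sqrt y)]
  refine norm_cfc_le (Real.sqrt_nonneg _) fun t ht => ?_
  rw [Real.norm_eq_abs, abs_le]
  constructor
  · refine (algebraMap_le_iff_le_spectrum hsa).1 ?_ t ht
    rw [map_neg, neg_le_sub_iff_le_add]
    exact h2
  · refine (le_algebraMap_iff_spectrum_le hsa).1 ?_ t ht
    rwa [sub_le_iff_le_add']

end PolarDecomposition

namespace CharacterAlgebra

variable {U : Type*} [CStarAlgebra U] {ρ : U →⋆ₐ[ℂ] ℂ} [PartialOrder U] [StarOrderedRing U]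

open ComplexOrder in
theorem character_sqrt_eq_one {a : U} (ha : ρ a = 1) : ρ (CFC.sqrt (star a * a)) = 1 := by
  have h0 : 0 ≤ ρ (CFC.sqrt (star a * a)) := map_nonneg ρ (CFC.sqrt_nonneg _)
  have h1 : ρ (CFC.sqrt (star a * a)) * ρ (CFC.sqrt (star a * a)) = 1 := by
    rw [← map_mul, CFC.sqrt_mul_sqrt_self _ (star_mul_self_nonneg a), map_mul, map_star, ha]
    simp
  rcases mul_self_eq_one_iff.1 h1 with h | h
  · exact h
  · rw [h] at h0
    exact absurd h0 (by simp [Complex.le_def])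

theorem exists_local_path (hd : Dense {x : U | IsUnit x})
    (hconn : ∀ w : U, IsUnit w → JoinedIn {x : U | IsUnit x} w 1)
    (hideal : ∀ I : TwoSidedIdeal U, IsClosed (I : Set U) → (∃ x ∈ I, ρ x = 0 ∧ x ≠ 0) →
      ∀ x, ρ x = 0 → x ∈ I)
    (happ : ∀ K : Set U, IsCompact K → (∀ x ∈ K, ρ x = 0) → ∀ ε > 0,
      ∃ e, ρ e = 0 ∧ ∀ x ∈ K, ‖x * e - x‖ < ε)
    (M : ℝ) {ε : ℝ} (hε : 0 < ε) :
    ∃ δ > 0, ∀ a b : U, IsUnit a → IsUnit b → ρ a = 1 → ρ b = 1 → ‖a‖ ≤ M → ‖a - b‖ < δ →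
      JoinedIn {x : U | IsUnit x ∧ ‖x - a‖ ≤ ε} a b := by
  obtain ⟨δ, hδ, hδM, hδε⟩ : ∃ δ > 0, δ < 1 ∧ √(δ * (2 * |M| + 1)) + δ < ε / 5 := by
    have hc : Continuous fun δ : ℝ => √(δ * (2 * |M| + 1)) + δ := by fun_prop
    have h1 : ∀ᶠ δ in nhds (0 : ℝ), √(δ * (2 * |M| + 1)) + δ < ε / 5 :=
      hc.continuousAt.eventually_lt_const (by simp [hε])
    have h2 : ∀ᶠ δ in nhds (0 : ℝ), δ < 1 := eventually_lt_nhds one_pos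
    obtain ⟨δ, h, h0⟩ := (((h1.and h2).filter_mono nhdsWithin_le_nhds).and
      (self_mem_nhdsWithin : Set.Ioi (0 : ℝ) ∈ nhdsWithin 0 (Set.Ioi 0))).exists
    exact ⟨δ, h0, h.2, h.1⟩
  refine ⟨δ, hδ, fun a b ha hb hρa hρb haM hab => ?_⟩
  obtain ⟨u, hu, hau⟩ := PolarDecomposition.exists_unitary_mul_sqrt ha
  obtain ⟨u', hu', hbu⟩ := PolarDecomposition.exists_unitary_mul_sqrt hb
  have hh := PolarDecomposition.isStrictlyPositive_sqrt_star_mul_self ha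
  have hk := PolarDecomposition.isStrictlyPositive_sqrt_star_mul_self hb
  have hρh := character_sqrt_eq_one hρa
  have hρk := character_sqrt_eq_one hρb
  have hhk : ‖CFC.sqrt (star a * a) - CFC.sqrt (star b * b)‖ ≤ √(δ * (2 * |M| + 1)) := by
    refine (PolarDecomposition.norm_sqrt_sub_sqrt_le (star_mul_self_nonneg a)
      (star_mul_self_nonneg b)).trans (Real.sqrt_le_sqrt ?_)
    have h1 : star a * a - star b * b = star a * (a - b) + star (a - b) * b := by
      rw [star_sub]; noncomm_ring
    have hbM : ‖b‖ ≤ |M| + 1 := by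
      have : b = a - (a - b) := by abel
      rw [this]
      exact (norm_sub_le _ _).trans (by linarith [le_abs_self M])
    have haM' := haM.trans (le_abs_self M)
    calc ‖star a * a - star b * b‖ ≤ ‖star a‖ * ‖a - b‖ + ‖star (a - b)‖ * ‖b‖ := by
          rw [h1]
          exact (norm_add_le _ _).trans (add_le_add (norm_mul_le _ _) (norm_mul_le _ _))
      _ ≤ |M| * δ + δ * (|M| + 1) := by
          rw [norm_star, norm_star]
          gcongr
      _ = δ * (2 * |M| + 1) := by ring
  set h := CFC.sqrt (star a * a) with hhdef
  set k := CFC.sqrt (star b * b) with hkdef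
  have hρu : ρ u = 1 := by rw [hau, map_mul, hρh, mul_one] at hρa; exact hρa
  have hρu' : ρ u' = 1 := by rw [hbu, map_mul, hρk, mul_one] at hρb; exact hρb
  set v := star u * u' with hv
  have hvU : v ∈ unitary U := mul_mem (Unitary.star_mem hu) hu'
  have hρv : ρ v = 1 := by rw [hv, map_mul, map_star, hρu, hρu']; simp
  have : Nontrivial U := (ρ : U →+* ℂ).domain_nontrivial
  have hun : ‖u‖ = 1 := CStarRing.norm_of_mem_unitary hu
  have hvn : ‖v‖ = 1 := CStarRing.norm_of_mem_unitary hvU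
  have huu : IsUnit u := ⟨Unitary.toUnits ⟨u, hu⟩, rfl⟩
  have hvu : IsUnit v := ⟨Unitary.toUnits ⟨v, hvU⟩, rfl⟩
  have hvk : ‖v * k - h‖ ≤ δ := by
    have h1 : v * k - h = star u * (b - a) := by
      rw [mul_sub, hbu, hau, hv, ← mul_assoc, ← mul_assoc, Unitary.star_mul_self_of_mem hu,
        one_mul]
    rw [h1]
    refine (norm_mul_le _ _).trans ?_
    rw [norm_star, hun, one_mul, norm_sub_rev]
    exact hab.le
  have hvhk : ‖v * (h - k)‖ ≤ √(δ * (2 * |M| + 1)) :=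
    (norm_mul_le _ _).trans (by rwa [hvn, one_mul])
  have hvh : ‖v * h - h‖ < ε / 5 := by
    have h1 : v * h - h = v * (h - k) + (v * k - h) := by noncomm_ring
    rw [h1]
    exact (norm_add_le _ _).trans_lt (by linarith)
  have hsub : {x : U | IsUnit x ∧ ‖x - h‖ ≤ 5 * (ε / 5)} ⊆ {x | IsUnit x ∧ ‖x - h‖ ≤ ε} := by
    rintro x ⟨h1, h2⟩
    exact ⟨h1, h2.trans (by linarith)⟩
  have J1 : JoinedIn {x : U | IsUnit x ∧ ‖x - h‖ ≤ ε} h (v * h) :=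
    ((joinedIn_unitary_mul hd hconn hideal happ hvU hρv hh (by positivity) hvh).mono hsub).symm
  have J2 : JoinedIn {x : U | IsUnit x ∧ ‖x - h‖ ≤ ε} (v * h) (v * k) := by
    refine JoinedIn.ofLine (f := fun t : ℝ => v * ((1 - t) • h + t • k)) (by fun_prop) (by simp)
      (by simp) ?_
    rintro _ ⟨t, ht, rfl⟩
    refine ⟨hvu.mul (PolarDecomposition.isStrictlyPositive_convex hh hk ht).isUnit, ?_⟩
    have h1 : v * ((1 - t) • h + t • k) - h = (1 - t) • (v * (h - k)) + (v * k - h) := by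
      rw [mul_add, mul_smul_comm, mul_smul_comm, mul_sub]
      module
    simp only [h1]
    refine (norm_add_le _ _).trans ?_
    rw [norm_smul, Real.norm_of_nonneg (by linarith [ht.2])]
    have h2 : (1 - t) * ‖v * (h - k)‖ ≤ 1 * √(δ * (2 * |M| + 1)) := by
      gcongr
      linarith [ht.1]
    linarith
  have J := (J1.trans J2).map (f := fun x => u * x) (by fun_prop)
  have hb' : b = u * (v * k) := by
    rw [hv, ← mul_assoc, ← mul_assoc, Unitary.mul_star_self_of_mem hu, one_mul, ← hbu]
  rw [← hau, ← hb'] at J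
  refine J.mono ?_
  rintro _ ⟨x, ⟨hx, hxh⟩, rfl⟩
  refine ⟨huu.mul hx, ?_⟩
  have h1 : u * x - a = u * (x - h) := by rw [mul_sub, ← hau]
  simp only [h1]
  exact (norm_mul_le _ _).trans (by rwa [hun, one_mul])

end CharacterAlgebra

theorem exists_continuous_concat {X : Type*} [TopologicalSpace X] {a : ℕ → X} {S : ℕ → Set X}
    (h : ∀ i, JoinedIn (S i) (a i) (a (i + 1))) (n : ℕ) :
    ∃ g : ℝ → X, Continuous g ∧ g n = a n ∧ ∀ i < n, ∀ t ∈ Set.Icc (i : ℝ) (i + 1), g t ∈ S i := by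
  induction n with
  | zero => exact ⟨fun _ => a 0, continuous_const, rfl, fun i hi => absurd hi i.not_lt_zero⟩
  | succ n ih =>
    obtain ⟨g, hg, hgn, hgS⟩ := ih
    refine ⟨fun t => if t ≤ n then g t else (h n).somePath.extend (t - n), ?_, ?_, fun i hi t ht => ?_⟩
    · refine Continuous.if_le hg ((Path.continuous_extend _).comp (by fun_prop)) continuous_id
        continuous_const ?_
      rintro t rfl
      simp [hgn]
    · simp
    · have hmem : ∀ s : ℝ, (h n).somePath.extend s ∈ S n := fun s =>
        (h n).somePath_mem (Set.projIcc 0 1 zero_le_one s)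
      rcases Nat.lt_succ_iff_lt_or_eq.1 hi with hi | rfl
      · have : t ≤ n := ht.2.trans (by exact_mod_cast hi)
        simpa [this] using hgS i hi t ht
      · by_cases hti : t ≤ i
        · obtain rfl : t = i := le_antisymm hti ht.1
          simpa [hgn] using (h i).source_mem
        · simpa [hti] using hmem _

namespace CharacterAlgebra

variable {U : Type*} [CStarAlgebra U] {ρ : U →⋆ₐ[ℂ] ℂ}

theorem exists_isUnit_near (hd : Dense {x : U | IsUnit x}) {x : U} (hx : ρ x = 1) {ε : ℝ}
    (hε : 0 < ε) : ∃ a : U, IsUnit a ∧ ρ a = 1 ∧ ‖a - x‖ < ε := by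
  have hρ : Continuous ρ := map_continuous ρ
  have h0 : ρ x ≠ 0 := by simp [hx]
  have hN : ContinuousAt (fun y => ‖(ρ y)⁻¹ • y - x‖) x :=
    (((hρ.continuousAt.inv₀ h0).smul continuousAt_id).sub continuousAt_const).norm
  have h1 := hN.eventually_lt_const (u := ε) (by simpa [hx] using hε)
  have h2 := hρ.continuousAt.eventually_ne h0
  obtain ⟨y, hy, hy1, hy2⟩ := ((mem_closure_iff_frequently.1 (hd x)).and_eventually
    (h1.and h2)).exists
  refine ⟨(ρ y)⁻¹ • y, IsUnit.smul (Units.mk0 _ (inv_ne_zero hy2)) hy, ?_, hy1⟩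
  rw [map_smul, smul_eq_mul, inv_mul_cancel₀ hy2]

theorem norm_inv_smul_sub_le {x y : U} {ε M : ℝ} (hε : ε ≤ 1 / 2) (hy : ρ y = 1) (hM : ‖y‖ ≤ M)
    (hxy : ‖x - y‖ ≤ ε) : ‖(ρ x)⁻¹ • x - y‖ ≤ (2 * M + 2) * ε := by
  have h1 : ‖ρ x - 1‖ ≤ ε := by
    rw [← hy, ← map_sub]
    exact (NonUnitalStarAlgHom.norm_apply_le ρ _).trans hxy
  have h2 : 1 / 2 ≤ ‖ρ x‖ := by
    have := norm_sub_norm_le (1 : ℂ) (1 - ρ x)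
    rw [norm_one, norm_sub_rev, sub_sub_cancel] at this
    linarith
  have h0 : ρ x ≠ 0 := norm_pos_iff.1 (by linarith)
  have h3 : (ρ x)⁻¹ • x - y = (ρ x)⁻¹ • ((x - y) - (ρ x - 1) • y) := by
    rw [sub_smul, one_smul, smul_sub, smul_sub, smul_sub, inv_smul_smul₀ h0]
    abel
  have h4 : ‖(ρ x)⁻¹‖ ≤ 2 := by
    rw [norm_inv]
    exact inv_le_of_inv_le₀ (by norm_num) (by linarith)
  have hε0 := (norm_nonneg _).trans h1
  rw [h3, norm_smul]
  calc _ ≤ 2 * (ε + ε * M) := by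
        gcongr
        refine (norm_sub_le _ _).trans ?_
        rw [norm_smul]
        gcongr
    _ = _ := by ring

variable [PartialOrder U] [StarOrderedRing U]

theorem exists_isUnit_map_near (hd : Dense {x : U | IsUnit x})
    (hconn : ∀ w : U, IsUnit w → JoinedIn {x : U | IsUnit x} w 1)
    (hideal : ∀ I : TwoSidedIdeal U, IsClosed (I : Set U) → (∃ x ∈ I, ρ x = 0 ∧ x ≠ 0) →
      ∀ x, ρ x = 0 → x ∈ I)
    (happ : ∀ K : Set U, IsCompact K → (∀ x ∈ K, ρ x = 0) → ∀ ε > 0,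
      ∃ e, ρ e = 0 ∧ ∀ x ∈ K, ‖x * e - x‖ < ε)
    (f : C(unitInterval, U)) (hf : ∀ t, ρ (f t) = 1) {ε : ℝ} (hε : 0 < ε) :
    ∃ g : C(unitInterval, U), ∀ t, IsUnit (g t) ∧ ρ (g t) = 1 ∧ ‖g t - f t‖ < ε := by
  obtain ⟨ε', hε', hε'2, hε'ε⟩ : ∃ ε' > 0, 3 * ε' ≤ 1 / 2 ∧ (2 * ‖f‖ + 2) * (3 * ε') < ε := by
    have hM := norm_nonneg f
    refine ⟨min (1 / 6) (ε / (2 * (3 * (2 * ‖f‖ + 2)))), by positivity, ?_, ?_⟩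
    · linarith [min_le_left (1 / 6 : ℝ) (ε / (2 * (3 * (2 * ‖f‖ + 2))))]
    · have h1 := min_le_right (1 / 6 : ℝ) (ε / (2 * (3 * (2 * ‖f‖ + 2))))
      rw [le_div_iff₀ (by positivity)] at h1
      nlinarith
  obtain ⟨δ, hδ, hpath⟩ := exists_local_path hd hconn hideal happ (‖f‖ + 1) hε'
  obtain ⟨η, hη, hη1, hηδ, hηε⟩ : ∃ η > 0, η ≤ 1 ∧ 3 * η ≤ δ ∧ η ≤ ε' := by
    refine ⟨min 1 (min (δ / 3) ε'), by positivity, min_le_left _ _, ?_,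
      (min_le_right _ _).trans (min_le_right _ _)⟩
    linarith [(min_le_right 1 (min (δ / 3) ε')).trans (min_le_left _ _)]
  set F : ℝ → U := fun t => f (Set.projIcc 0 1 zero_le_one t) with hF
  have hFu : UniformContinuous F :=
    (CompactSpace.uniformContinuous_of_continuous f.continuous).comp
      (LipschitzWith.projIcc zero_le_one).uniformContinuous
  obtain ⟨δ', hδ', hFδ⟩ := Metric.uniformContinuous_iff.1 hFu η hη
  obtain ⟨N, hN⟩ := exists_nat_one_div_lt hδ'
  have hN0 : (0 : ℝ) < N + 1 := by positivity
  choose a ha hρa haF using fun i : ℕ =>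
    exists_isUnit_near hd (hf (Set.projIcc 0 1 zero_le_one ((i : ℝ) / (N + 1)))) hη
  have hstep : ∀ s t : ℝ, |s - t| ≤ 1 → ‖F (s / (N + 1)) - F (t / (N + 1))‖ < η := by
    intro s t hst
    rw [← dist_eq_norm]
    apply hFδ
    rw [Real.dist_eq, ← sub_div, abs_div, abs_of_pos hN0]
    exact lt_of_le_of_lt (by gcongr) hN
  have haM : ∀ i, ‖a i‖ ≤ ‖f‖ + 1 := fun i => by
    have h1 := norm_sub_norm_le (a i) (F ((i : ℝ) / (N + 1)))
    have h2 : ‖F ((i : ℝ) / (N + 1))‖ ≤ ‖f‖ := f.norm_coe_le_norm _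
    linarith [haF i]
  have haa : ∀ i, ‖a i - a (i + 1)‖ < δ := fun i => by
    have h1 := hstep i (i + 1 : ℕ) (by simp)
    have h2 : a i - a (i + 1) = (a i - F ((i : ℝ) / (N + 1))) +
        (F ((i : ℝ) / (N + 1)) - F (((i + 1 : ℕ) : ℝ) / (N + 1))) -
        (a (i + 1) - F (((i + 1 : ℕ) : ℝ) / (N + 1))) := by abel
    rw [h2]
    have h3 := haF i
    have h4 := haF (i + 1)
    refine ((norm_sub_le _ _).trans (add_le_add_left (norm_add_le _ _) _)).trans_lt ?_
    linarith
  obtain ⟨g, hg, -, hgS⟩ := exists_continuous_concat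
    (fun i => hpath _ _ (ha i) (ha (i + 1)) (hρa i) (hρa (i + 1)) (haM i) (haa i)) (N + 2)
  have key : ∀ t : unitInterval, IsUnit (g ((N + 1) * t)) ∧ ‖g ((N + 1) * t) - f t‖ ≤ 3 * ε' := by
    intro t
    set s : ℝ := (N + 1) * t with hs
    have hs0 : 0 ≤ s := mul_nonneg hN0.le t.2.1
    have hfl := Nat.floor_le hs0
    have hlt := Nat.lt_floor_add_one s
    have hi : ⌊s⌋₊ < N + 2 := by
      have h1 : s ≤ ((N + 1 : ℕ) : ℝ) := by
        push_cast
        exact mul_le_of_le_one_right hN0.le t.2.2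
      have := Nat.floor_le_of_le h1
      omega
    obtain ⟨h1, h2⟩ := hgS _ hi s ⟨hfl, hlt.le⟩
    refine ⟨h1, ?_⟩
    have hft : f t = F (s / (N + 1)) := by
      rw [hF, hs, mul_div_cancel_left₀ _ hN0.ne']
      simp
    have h3 := haF ⌊s⌋₊
    have h4 := hstep ⌊s⌋₊ s (by rw [abs_le]; constructor <;> linarith)
    have h5 : g s - f t = (g s - a ⌊s⌋₊) + (a ⌊s⌋₊ - F ((⌊s⌋₊ : ℝ) / (N + 1))) +
        (F ((⌊s⌋₊ : ℝ) / (N + 1)) - F (s / (N + 1))) := by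
      rw [hft]; abel
    rw [h5]
    refine (norm_add_le _ _).trans ((add_le_add_left (norm_add_le _ _) _).trans ?_)
    linarith
  have hρg : ∀ t : unitInterval, ρ (g ((N + 1) * t)) ≠ 0 := fun t => ((key t).1.map ρ).ne_zero
  refine ⟨⟨fun t => (ρ (g ((N + 1) * t)))⁻¹ • g ((N + 1) * t), ?_⟩, fun t => ⟨?_, ?_, ?_⟩⟩
  · have h1 : Continuous fun t : unitInterval => g ((N + 1) * t) := hg.comp (by fun_prop)
    exact (((map_continuous ρ).comp h1).inv₀ hρg).smul h1
  · exact IsUnit.smul (Units.mk0 _ (inv_ne_zero (hρg t))) (key t).1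
  · simp [map_smul, inv_mul_cancel₀ (hρg t)]
  · exact (norm_inv_smul_sub_le hε'2 (hf t) (f.norm_coe_le_norm t) (key t).2).trans_lt hε'ε

end CharacterAlgebra

namespace UnitizationCharacter

theorem inr_snd_eq {A : Type*} {x : Unitization ℂ A} (hx : x.fst = 0) : (x.snd : Unitization ℂ A) = x := by
  ext <;> simp [hx]

variable {A : Type*} [NonUnitalCStarAlgebra A]

variable (A) in
/-- The quotient map from the unitization onto the scalars. -/
def scalarPart : Unitization ℂ A →⋆ₐ[ℂ] ℂ where
  __ := Unitization.fstHom ℂ A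
  map_star' x := Unitization.fst_star x

theorem scalarPart_apply (x : Unitization ℂ A) : scalarPart A x = x.fst := rfl

theorem continuous_snd : Continuous fun x : Unitization ℂ A => x.snd :=
  _root_.continuous_snd.comp (Unitization.uniformEquivProd (𝕜 := ℂ) (A := A)).continuous

theorem mem_of_isClosed (hsimple : IsSimpleCStarAlgebra A) (I : TwoSidedIdeal (Unitization ℂ A))
    (hI : IsClosed (I : Set (Unitization ℂ A))) (hne : ∃ x ∈ I, scalarPart A x = 0 ∧ x ≠ 0)
    (x : Unitization ℂ A) (hx : scalarPart A x = 0) : x ∈ I := by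
  have hmem : ∀ a : A, a ∈ I.comap (Unitization.inrNonUnitalAlgHom ℂ A) ↔
      (a : Unitization ℂ A) ∈ I := fun a => TwoSidedIdeal.mem_comap _
  rcases hsimple.2 (I.comap (Unitization.inrNonUnitalAlgHom ℂ A)) (by
    have : ((I.comap (Unitization.inrNonUnitalAlgHom ℂ A) : TwoSidedIdeal A) : Set A) =
        (Unitization.inr : A → Unitization ℂ A) ⁻¹' I := Set.ext hmem
    rw [this]
    exact hI.preimage Unitization.continuous_inr) with h | h
  · obtain ⟨y, hyI, hy, hy0⟩ := hne
    rw [← inr_snd_eq hy, ← hmem, h, TwoSidedIdeal.mem_bot] at hyI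
    exact absurd (by rw [← inr_snd_eq hy, hyI, Unitization.inr_zero]) hy0
  · rw [← inr_snd_eq hx, ← hmem, h]
    trivial

theorem exists_approx_unit (K : Set (Unitization ℂ A)) (hK : IsCompact K)
    (hK0 : ∀ x ∈ K, scalarPart A x = 0) (ε : ℝ) (hε : 0 < ε) :
    ∃ e, scalarPart A e = 0 ∧ ∀ x ∈ K, ‖x * e - x‖ < ε := by
  let := CStarAlgebra.spectralOrder A
  have := CStarAlgebra.spectralOrderedRing A
  have hl := CStarAlgebra.increasingApproximateUnit A
  have := hl.neBot
  have key : ∀ᶠ e in CStarAlgebra.approximateUnit A, ∀ x ∈ K, ‖x.snd * e - x.snd‖ < ε := by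
    refine hK.induction_on (p := fun S => ∀ᶠ e in CStarAlgebra.approximateUnit A,
      ∀ x ∈ S, ‖x.snd * e - x.snd‖ < ε) (by simp) (fun S T hST h => ?_) (fun S T hS hT => ?_)
      fun x _ => ?_
    · exact h.mono fun e he x hx => he x (hST hx)
    · filter_upwards [hS, hT] with e h1 h2 x hx using hx.elim (h1 x) (h2 x)
    · refine ⟨{y | ‖y.snd - x.snd‖ < ε / 3}, mem_nhdsWithin_of_mem_nhds ?_, ?_⟩
      · have h1 : Continuous fun y : Unitization ℂ A => ‖y.snd - x.snd‖ :=
          (continuous_snd.sub continuous_const).norm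
        exact h1.continuousAt.eventually_lt_const (by simpa using hε)
      · have h1 : ∀ᶠ e in CStarAlgebra.approximateUnit A, ‖x.snd * e - x.snd‖ < ε / 3 := by
          have := ((hl.tendsto_mul_left x.snd).sub_const x.snd).norm
          rw [sub_self, norm_zero] at this
          exact this.eventually_lt_const (by positivity)
        filter_upwards [h1, hl.eventually_norm] with e he he1 y hy
        have h2 : y.snd * e - y.snd = (y.snd - x.snd) * e + (x.snd * e - x.snd) -
            (y.snd - x.snd) := by noncomm_ring
        have h3 : ‖(y.snd - x.snd) * e‖ ≤ ‖y.snd - x.snd‖ :=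
          (norm_mul_le _ _).trans (mul_le_of_le_one_right (norm_nonneg _) he1)
        have hy' : ‖y.snd - x.snd‖ < ε / 3 := hy
        rw [h2]
        refine ((norm_sub_le _ _).trans (add_le_add_left (norm_add_le _ _) _)).trans_lt ?_
        linarith
  obtain ⟨e, he⟩ := key.exists
  refine ⟨e, Unitization.fst_inr ℂ e, fun x hx => ?_⟩
  rw [← inr_snd_eq (hK0 x hx), ← Unitization.inr_mul, ← Unitization.inr_sub, Unitization.norm_inr]
  exact he x hx

theorem joinedIn_one (hsr : StableRankOne A) (hK1 : K1Trivial A) {w : Unitization ℂ A}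
    (hw : IsUnit w) : JoinedIn {x : Unitization ℂ A | IsUnit x} w 1 := by
  let := CStarAlgebra.spectralOrder (Unitization ℂ A)
  have := CStarAlgebra.spectralOrderedRing (Unitization ℂ A)
  refine PolarDecomposition.joinedIn_one (fun u hu => ?_) hw
  have hM : (Matrix.of fun _ _ => u : Matrix (Fin 1) (Fin 1) (Unitization ℂ A)) ∈
      unitary (Matrix (Fin 1) (Fin 1) (Unitization ℂ A)) := by
    rw [Unitary.mem_iff] at hu ⊢
    constructor <;> ext i j : 1 <;>
      simp [Matrix.mul_apply, Matrix.star_apply, hu.1, hu.2, Subsingleton.elim i j, Matrix.one_apply]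
  obtain ⟨k, h, hj⟩ := hK1 1 one_pos ⟨_, hM⟩
  exact StableCancellation.joinedIn_one_of_joined_unitary hsr h hj

/-- The path in the unitization of `A` with constant scalar part one. -/
def pathOf (F : C(unitInterval, A)) : C(unitInterval, Unitization ℂ A) :=
  ⟨fun t => 1 + F t, continuous_const.add (Unitization.continuous_inr.comp F.continuous)⟩

theorem isUnit_of_forall_isUnit {g : C(unitInterval, Unitization ℂ A)} {F : C(unitInterval, A)}
    (hg : ∀ t, IsUnit (g t)) (hg1 : ∀ t, (g t).fst = 1) (hF : ∀ t, (g t).snd = F t) :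
    IsUnit (1 + (F : Unitization ℂ C(unitInterval, A))) := by
  have hc : Continuous fun t => Ring.inverse (g t) := continuous_iff_continuousAt.2 fun t => by
    obtain ⟨v, hv⟩ := hg t
    exact ContinuousAt.comp (hv ▸ NormedRing.inverse_continuousAt v) g.continuous.continuousAt
  let G : C(unitInterval, A) := ⟨fun t => (Ring.inverse (g t)).snd, continuous_snd.comp hc⟩
  have hG : ∀ t, (Ring.inverse (g t)).fst = 1 := fun t => by
    have := congrArg (fun x => x.fst) (Ring.mul_inverse_cancel _ (hg t))
    simpa [hg1] using this
  have h1 : ∀ t, F t + G t + F t * G t = 0 := fun t => by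
    have := congrArg (fun x => x.snd) (Ring.mul_inverse_cancel _ (hg t))
    simp only [Unitization.snd_mul, hg1, hG, hF, one_smul, Unitization.snd_one] at this
    rw [add_comm (F t)]
    exact this
  have h2 : ∀ t, F t + G t + G t * F t = 0 := fun t => by
    have := congrArg (fun x => x.snd) (Ring.inverse_mul_cancel _ (hg t))
    simp only [Unitization.snd_mul, hg1, hG, hF, one_smul, Unitization.snd_one] at this
    exact this
  refine ⟨⟨1 + F, 1 + G, ?_, ?_⟩, rfl⟩
  · have : (1 + (F : Unitization ℂ C(unitInterval, A))) * (1 + G) = 1 + (F + G + F * G :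
        C(unitInterval, A)) := by
      simp only [Unitization.inr_add, Unitization.inr_mul]
      noncomm_ring
    rw [this, show F + G + F * G = 0 from ContinuousMap.ext h1, Unitization.inr_zero, add_zero]
  · have : (1 + (G : Unitization ℂ C(unitInterval, A))) * (1 + F) = 1 + (F + G + G * F :
        C(unitInterval, A)) := by
      simp only [Unitization.inr_add, Unitization.inr_mul]
      noncomm_ring
    rw [this, show F + G + G * F = 0 from ContinuousMap.ext h2, Unitization.inr_zero, add_zero]

theorem dense_of_forall_one_add_mem_closure
    (h : ∀ a : A, 1 + (a : Unitization ℂ A) ∈ closure {x : Unitization ℂ A | IsUnit x}) :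
    StableRankOne A := by
  have h1 : ∀ x : Unitization ℂ A, x.fst ≠ 0 → x ∈ closure {x : Unitization ℂ A | IsUnit x} := by
    intro x hx
    have h2 : x = x.fst • (1 + ((x.fst⁻¹ • x.snd : A) : Unitization ℂ A)) := by
      ext <;> simp [hx]
    rw [h2]
    refine map_mem_closure (continuous_const_smul x.fst) (h _) fun y hy => ?_
    exact IsUnit.smul (Units.mk0 _ hx) hy
  intro x
  by_cases hx : x.fst = 0
  · have hc : Continuous fun s : ℂ => x + s • (1 : Unitization ℂ A) := by fun_prop
    have h0 : (0 : ℂ) ∈ closure {s : ℂ | s ≠ 0} := dense_compl_singleton (0 : ℂ) 0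
    have := map_mem_closure hc h0 (t := closure {x : Unitization ℂ A | IsUnit x})
      fun s hs => h1 _ (by simpa [hx] using hs)
    simpa using this
  · exact h1 x hx

end UnitizationCharacter

theorem stmt3 (A : Type*) [NonUnitalCStarAlgebra A] (hsimple : IsSimpleCStarAlgebra A)
    (hsr : StableRankOne A) (hK1 : K1Trivial A) :
    StableRankOne C(unitInterval, A) := by
  let := CStarAlgebra.spectralOrder (Unitization ℂ A)
  have := CStarAlgebra.spectralOrderedRing (Unitization ℂ A)
  refine UnitizationCharacter.dense_of_forall_one_add_mem_closure fun F =>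
    Metric.mem_closure_iff.2 fun ε hε => ?_
  obtain ⟨g, hg⟩ := CharacterAlgebra.exists_isUnit_map_near
    (ρ := UnitizationCharacter.scalarPart A) hsr
    (fun w => UnitizationCharacter.joinedIn_one hsr hK1)
    (UnitizationCharacter.mem_of_isClosed hsimple) UnitizationCharacter.exists_approx_unit
    (UnitizationCharacter.pathOf F)
    (fun t => by simp [UnitizationCharacter.pathOf, UnitizationCharacter.scalarPart_apply]) hε
  let G : C(unitInterval, A) := ⟨fun t => (g t).snd,
    UnitizationCharacter.continuous_snd.comp g.continuous⟩
  refine ⟨1 + G, UnitizationCharacter.isUnit_of_forall_isUnit (fun t => (hg t).1)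
    (fun t => (hg t).2.1) fun t => rfl, ?_⟩
  rw [dist_eq_norm, norm_sub_rev, add_sub_add_left_eq_sub, ← Unitization.inr_sub,
    Unitization.norm_inr, ContinuousMap.norm_lt_iff _ hε]
  intro t
  rw [← Unitization.norm_inr (𝕜 := ℂ)]
  have h1 : (g t).fst = 1 := (hg t).2.1
  have h2 : g t = 1 + (G t : Unitization ℂ A) := by ext <;> simp [h1, G]
  have h3 := (hg t).2.2
  rw [h2, show UnitizationCharacter.pathOf F t = 1 + (F t : Unitization ℂ A) from rfl,
    add_sub_add_left_eq_sub, ← Unitization.inr_sub] at h3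
  exact h3
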